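/- arXiv:1202.6310 — 5 statements merged into one kernel-verified Lean document; each statement's English description precedes it below -/
import Mathlib

section
/- Every open cover of a hereditarily meta-Lindelöf, locally compact, scattered Tychonoff space of countable Cantor–Bendixson height has a point-finite clopen refinement. -/
open Set Topology Ordinal Cardinal

noncomputable section
universe u

/-- A topological space is *scattered* if every nonempty subset has a point isolated
in the subspace topology, i.e. there is an open set meeting the subset in exactly
that point. -/
def IsScattered (X : Type*) [TopologicalSpace X] : Prop :=
  ∀ S : Set X, S.Nonempty → ∃ x ∈ S, ∃ U : Set X, IsOpen U ∧ U ∩ S = {x}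

/-- A space is *meta-Lindelöf* if every open cover has a point-countable open refinement. -/
def IsMetaLindelof (X : Type*) [TopologicalSpace X] : Prop :=
  ∀ 𝒰 : Set (Set X), (∀ U ∈ 𝒰, IsOpen U) → ⋃₀ 𝒰 = Set.univ →
    ∃ 𝒱 : Set (Set X), (∀ V ∈ 𝒱, IsOpen V) ∧ ⋃₀ 𝒱 = Set.univ ∧
      (∀ V ∈ 𝒱, ∃ U ∈ 𝒰, V ⊆ U) ∧ ∀ x : X, {V ∈ 𝒱 | x ∈ V}.Countable

/-- A space is *hereditarily meta-Lindelöf* if every subspace is meta-Lindelöf. -/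
def HereditarilyMetaLindelof (X : Type*) [TopologicalSpace X] : Prop :=
  ∀ S : Set X, IsMetaLindelof S

/-- A space is *σ-discrete* if it is a countable union of subspaces, each of which is
discrete in its subspace topology. -/
def IsSigmaDiscrete (X : Type*) [TopologicalSpace X] : Prop :=
  ∃ D : ℕ → Set X, (⋃ n, D n) = Set.univ ∧ ∀ n, DiscreteTopology (D n)

/-- The Cantor–Bendixson derivatives `cbDeriv X α = X^(α)`: for each `β < α` we intersect
the set of non-isolated points of `X^(β)`.  This agrees with the usual transfinite
iteration: `X^(0) = X`, `X^(α+1)` is the set of non-isolated points of `X^(α)`, and at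
limit ordinals one takes intersections. -/
def cbDeriv (X : Type*) [TopologicalSpace X] (o : Ordinal) : Set X :=
  ⋂ p : {b : Ordinal // b < o},
    (cbDeriv X p.1 ∩ {x | x ∈ closure (cbDeriv X p.1 \ {x})})
termination_by o
decreasing_by exact p.2

/-- The Cantor–Bendixson height of a space: the least ordinal `α` with `X^(α) = ∅`. -/
def cbHeight (X : Type*) [TopologicalSpace X] : Ordinal :=
  sInf {o : Ordinal | cbDeriv X o = ∅}

/-- A space `X` is *Eberlein–Grothendieck* if it embeds into `C_p(K)`, the space of
continuous real-valued functions on a compact Hausdorff space `K` with the topology of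
pointwise convergence (the subspace topology from the product topology on `K → ℝ`). -/
def EberleinGrothendieck (X : Type u) [TopologicalSpace X] : Prop :=
  ∃ (K : Type u) (_ : TopologicalSpace K), CompactSpace K ∧ T2Space K ∧
    ∃ f : X → {g : K → ℝ // Continuous g}, IsEmbedding f

/-- The weight of a topological space: the least cardinality of a base for the topology. -/
def tweight (X : Type u) [TopologicalSpace X] : Cardinal.{u} :=
  sInf {c : Cardinal.{u} | ∃ B : Set (Set X), TopologicalSpace.IsTopologicalBasis B ∧ #B = c}

/-- A space is *locally countable* if every point has a countable open neighborhood. -/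
def LocallyCountable (X : Type*) [TopologicalSpace X] : Prop :=
  ∀ x : X, ∃ U : Set X, IsOpen U ∧ x ∈ U ∧ U.Countable

/-- If every point has a neighbourhood on which it has strictly largest rank, then the points of
maximal rank in a compact set form a finite set, which is nonempty if the set is. -/
theorem IsCompact.finite_setOf_max_rank {X : Type*} [TopologicalSpace X] {β : Type*}
    [LinearOrder β] {rk : X → β}
    (hrk : ∀ x, ∃ U, IsOpen U ∧ x ∈ U ∧ ∀ y ∈ U, y ≠ x → rk y < rk x)
    {K : Set X} (hK : IsCompact K) :
    {x ∈ K | ∀ y ∈ K, rk y ≤ rk x}.Finite ∧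
      (K.Nonempty → {x ∈ K | ∀ y ∈ K, rk y ≤ rk x}.Nonempty) := by
  choose U hUo hxU hU using hrk
  obtain ⟨t, htK, ht⟩ := hK.elim_nhds_subcover U fun x _ => (hUo x).mem_nhds (hxU x)
  have hle : ∀ y ∈ K, ∃ x ∈ t, y = x ∨ rk y < rk x := fun y hy => by
    obtain ⟨x, hxt, hyx⟩ := mem_iUnion₂.1 (ht hy)
    exact ⟨x, hxt, or_iff_not_imp_left.2 (hU x y hyx)⟩
  refine ⟨t.finite_toSet.subset ?_, ?_⟩
  · rintro y ⟨hy, hmax⟩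
    obtain ⟨x, hxt, rfl | hlt⟩ := hle y hy
    · exact hxt
    · exact absurd (hmax x (htK x hxt)) hlt.not_ge
  · rintro ⟨y, hy⟩
    obtain ⟨x, hxt, -⟩ := hle y hy
    obtain ⟨m, hmt, hm⟩ := t.exists_max_image rk ⟨x, hxt⟩
    refine ⟨m, htK m hmt, fun w hw => ?_⟩
    obtain ⟨v, hvt, rfl | hlt⟩ := hle w hw
    · exact hm _ hvt
    · exact hlt.le.trans (hm v hvt)

theorem cbDeriv_antitone (X : Type*) [TopologicalSpace X] : Antitone (cbDeriv X) := by
  intro a b hab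
  rcases hab.eq_or_lt with rfl | hab
  · exact subset_rfl
  · intro x hx
    rw [cbDeriv, mem_iInter] at hx
    exact (hx ⟨a, hab⟩).1

/-- A scattered space carries the Cantor–Bendixson rank: each point has strictly largest rank in
one of its neighbourhoods. -/
theorem IsScattered.exists_rank {X : Type u} [TopologicalSpace X] (hsc : IsScattered X) :
    ∃ rk : X → Ordinal.{u},
      ∀ x, ∃ U, IsOpen U ∧ x ∈ U ∧ ∀ y ∈ U, y ≠ x → rk y < rk x := by
  have hne : ∀ x : X, {o : Ordinal.{u} | x ∉ cbDeriv X o}.Nonempty := by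
    by_contra! hcon
    obtain ⟨x₀, hx₀⟩ := hcon
    have hx₀' : ∀ o : Ordinal.{u}, x₀ ∈ cbDeriv X o := fun o => by
      by_contra h
      exact (eq_empty_iff_forall_notMem.1 hx₀ o) h
    obtain ⟨x, hx, U, hU, hUS⟩ := hsc {x | ∀ o : Ordinal.{u}, x ∈ cbDeriv X o} ⟨x₀, hx₀'⟩
    have hy : ∀ y : X, ∃ o : Ordinal.{u}, y ∈ U → y ≠ x → y ∉ cbDeriv X o := by
      intro y
      by_cases hyS : ∀ o : Ordinal.{u}, y ∈ cbDeriv X o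
      · exact ⟨0, fun hyU hyx => absurd (hUS.subset ⟨hyU, hyS⟩) hyx⟩
      · push Not at hyS
        exact hyS.imp fun o ho _ _ => ho
    choose o ho using hy
    have hxU : x ∈ U := (hUS.symm.subset rfl).1
    have hx' := hx (Order.succ (⨆ y, o y))
    rw [cbDeriv, mem_iInter] at hx'
    have hcl := (hx' ⟨_, Order.lt_succ _⟩).2
    obtain ⟨y, hyU, hyD, hyx⟩ := mem_closure_iff.1 hcl U hU hxU
    exact ho y hyU hyx (cbDeriv_antitone X (Ordinal.le_iSup o y) hyD)
  refine ⟨fun x => sInf {o | x ∉ cbDeriv X o}, fun x => ?_⟩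
  have hx := csInf_mem (hne x)
  rw [mem_ofPred_eq, cbDeriv, mem_iInter] at hx
  push Not at hx
  obtain ⟨⟨b, hb⟩, hxb⟩ := hx
  have hxmem : x ∈ cbDeriv X b := by
    by_contra h
    exact notMem_of_lt_csInf' hb h
  have hcl : x ∉ closure (cbDeriv X b \ {x}) := fun h => hxb ⟨hxmem, h⟩
  rw [mem_closure_iff] at hcl
  push Not at hcl
  obtain ⟨U, hU, hxU, hemp⟩ := hcl
  refine ⟨U, hU, hxU, fun y hy hyx => lt_of_le_of_lt (csInf_le' ?_) hb⟩
  exact fun hyb => (eq_empty_iff_forall_notMem.1 hemp y) ⟨hy, hyb, hyx⟩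

theorem IsScattered.totallyDisconnectedSpace {X : Type*} [TopologicalSpace X] [T1Space X]
    (hsc : IsScattered X) : TotallyDisconnectedSpace X := by
  refine ⟨fun S _ hS => ?_⟩
  rcases S.eq_empty_or_nonempty with rfl | hne
  · exact subsingleton_empty
  obtain ⟨x, hx, U, hU, hUS⟩ := hsc S hne
  have hxU : x ∈ U := (hUS.symm.subset rfl).1
  suffices h : ∀ y ∈ S, y = x from fun a ha b hb => (h a ha).trans (h b hb).symm
  intro y hy
  by_contra hyx
  obtain ⟨z, hzS, hzU, hzx⟩ := hS U {x}ᶜ hU isOpen_compl_singleton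
    (fun z _ => or_iff_not_imp_right.2 fun h => by rwa [not_not.1 h])
    ⟨x, hx, hxU⟩ ⟨y, hy, hyx⟩
  exact hzx (hUS.subset ⟨hzU, hzS⟩)

theorem exists_isCompact_isOpen_subset {X : Type*} [TopologicalSpace X] [T2Space X]
    [LocallyCompactSpace X] [TotallyDisconnectedSpace X] {U : Set X} (hU : IsOpen U) {x : X}
    (hx : x ∈ U) : ∃ C, IsCompact C ∧ IsOpen C ∧ x ∈ C ∧ C ⊆ U := by
  obtain ⟨N, hN, hxN, hNU⟩ := exists_compact_subset hU hx
  obtain ⟨C, hC, hxC, hCN⟩ :=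
    (loc_compact_Haus_tot_disc_of_zero_dim (H := X)).exists_subset_of_mem_open hxN isOpen_interior
  have hCN' : C ⊆ N := hCN.trans interior_subset
  exact ⟨C, hN.of_isClosed_subset hC.1 hCN', hC.2, hxC, hCN'.trans hNU⟩

theorem HereditarilyMetaLindelof.exists_pointCountable_refinement {X : Type*}
    [TopologicalSpace X] (h : HereditarilyMetaLindelof X) {𝒰 : Set (Set X)}
    (h𝒰 : ∀ U ∈ 𝒰, IsOpen U) :
    ∃ 𝒱 : Set (Set X), (∀ V ∈ 𝒱, IsOpen V) ∧ ⋃₀ 𝒱 = ⋃₀ 𝒰 ∧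
      (∀ V ∈ 𝒱, ∃ U ∈ 𝒰, V ⊆ U) ∧ ∀ x : X, {V ∈ 𝒱 | x ∈ V}.Countable := by
  obtain ⟨𝒱, hVo, hVc, hVr, hVp⟩ := h (⋃₀ 𝒰)
    ((fun U => ((↑) : ⋃₀ 𝒰 → X) ⁻¹' U) '' 𝒰)
    (by rintro _ ⟨U, hU, rfl⟩; exact (h𝒰 U hU).preimage continuous_subtype_val)
    (by
      refine eq_univ_of_forall fun x => ?_
      obtain ⟨U, hU, hxU⟩ := x.2
      exact ⟨_, ⟨U, hU, rfl⟩, hxU⟩)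
  refine ⟨(fun V => ((↑) : ⋃₀ 𝒰 → X) '' V) '' 𝒱, ?_, ?_, ?_, ?_⟩
  · rintro _ ⟨V, hV, rfl⟩
    exact (isOpen_sUnion h𝒰).isOpenMap_subtype_val V (hVo V hV)
  · refine subset_antisymm ?_ fun x hx => ?_
    · rintro x ⟨_, ⟨V, -, rfl⟩, ⟨y, -, rfl⟩⟩
      exact y.2
    · obtain ⟨V, hV, hxV⟩ := hVc.symm.subset (mem_univ (⟨x, hx⟩ : ⋃₀ 𝒰))
      exact ⟨_, ⟨V, hV, rfl⟩, ⟨_, hxV, rfl⟩⟩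
  · rintro _ ⟨V, hV, rfl⟩
    obtain ⟨_, ⟨U, hU, rfl⟩, hVU⟩ := hVr V hV
    exact ⟨U, hU, image_subset_iff.2 hVU⟩
  · intro x
    by_cases hx : x ∈ ⋃₀ 𝒰
    · refine ((hVp ⟨x, hx⟩).image fun V => ((↑) : ⋃₀ 𝒰 → X) '' V).mono ?_
      rintro _ ⟨⟨V, hV, rfl⟩, ⟨y, hy, rfl⟩⟩
      exact ⟨V, ⟨hV, hy⟩, rfl⟩
    · convert countable_empty
      refine eq_empty_of_forall_notMem ?_
      rintro _ ⟨⟨V, hV, rfl⟩, ⟨y, hy, rfl⟩⟩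
      exact hx y.2

/-- Point-countable covers of the members of a point-countable family combine to a point-countable
cover of the union of the family. -/
theorem exists_pointCountable_sUnion {X : Type*} {p : Set X → Prop} {𝒱 : Set (Set X)}
    (h𝒱 : ∀ x, {V ∈ 𝒱 | x ∈ V}.Countable)
    (h : ∀ V ∈ 𝒱, ∃ 𝒲 : Set (Set X), (∀ W ∈ 𝒲, p W) ∧ ⋃₀ 𝒲 = V ∧
      ∀ x, {W ∈ 𝒲 | x ∈ W}.Countable) :
    ∃ 𝒲 : Set (Set X), (∀ W ∈ 𝒲, p W ∧ ∃ V ∈ 𝒱, W ⊆ V) ∧ ⋃₀ 𝒲 = ⋃₀ 𝒱 ∧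
      ∀ x, {W ∈ 𝒲 | x ∈ W}.Countable := by
  choose! 𝒲 hp hc hx using h
  have hsub : ∀ V ∈ 𝒱, ∀ W ∈ 𝒲 V, W ⊆ V := fun V hV W hW =>
    (subset_sUnion_of_mem hW).trans (hc V hV).subset
  refine ⟨⋃ V ∈ 𝒱, 𝒲 V, ?_, ?_, ?_⟩
  · intro W hW
    obtain ⟨V, hV, hW⟩ := mem_iUnion₂.1 hW
    exact ⟨hp V hV W hW, V, hV, hsub V hV W hW⟩
  · refine subset_antisymm ?_ ?_
    · rintro x ⟨W, hW, hxW⟩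
      obtain ⟨V, hV, hW⟩ := mem_iUnion₂.1 hW
      exact ⟨V, hV, hsub V hV W hW hxW⟩
    · rintro x ⟨V, hV, hxV⟩
      obtain ⟨W, hW, hxW⟩ := (hc V hV).symm.subset hxV
      exact ⟨W, mem_iUnion₂.2 ⟨V, hV, hW⟩, hxW⟩
  · intro x
    refine ((h𝒱 x).biUnion fun V hV => hx V hV.1 x).mono ?_
    rintro W ⟨hW, hxW⟩
    obtain ⟨V, hV, hW⟩ := mem_iUnion₂.1 hW
    exact mem_iUnion₂.2 ⟨V, ⟨hV, hsub V hV W hW hxW⟩, hW, hxW⟩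

/-- Open subsets of compact sets in a hereditarily meta-Lindelöf scattered space are unions of
point-countable families of compact open sets. -/
theorem HereditarilyMetaLindelof.exists_pointCountable_compact_cover_of_subset_isCompact
    {X : Type u} [TopologicalSpace X] [T2Space X] [LocallyCompactSpace X]
    [TotallyDisconnectedSpace X] (hml : HereditarilyMetaLindelof X) {rk : X → Ordinal.{u}}
    (hrk : ∀ x, ∃ U, IsOpen U ∧ x ∈ U ∧ ∀ y ∈ U, y ≠ x → rk y < rk x) (α : Ordinal.{u}) :
    ∀ K : Set X, IsCompact K → (∀ x ∈ K, rk x < α) → ∀ O ⊆ K, IsOpen O →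
      ∃ 𝒲 : Set (Set X), (∀ W ∈ 𝒲, IsCompact W ∧ IsOpen W) ∧ ⋃₀ 𝒲 = O ∧
        ∀ x, {W ∈ 𝒲 | x ∈ W}.Countable := by
  induction α using WellFoundedLT.induction with
  | ind α ih =>
  intro K hK hKα O hOK hO
  rcases O.eq_empty_or_nonempty with rfl | hne
  · exact ⟨∅, by simp, by simp, by simp⟩
  obtain ⟨hfin, hnon⟩ := hK.finite_setOf_max_rank hrk
  set T := {x ∈ K | ∀ y ∈ K, rk y ≤ rk x}
  obtain ⟨t, htK, ht⟩ := hnon (hne.mono hOK)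
  obtain ⟨𝒱, hVo, hVc, hVr, hVp⟩ := hml.exists_pointCountable_refinement
    (𝒰 := {U | IsCompact U ∧ IsOpen U ∧ U ⊆ O \ T}) fun U hU => hU.2.1
  have hzd : ∀ U : Set X, IsOpen U → ∀ x ∈ U, ∃ C, IsCompact C ∧ IsOpen C ∧ x ∈ C ∧ C ⊆ U :=
    fun U hU x hx => exists_isCompact_isOpen_subset hU hx
  have hunion : ⋃₀ 𝒱 = O \ T := by
    rw [hVc]
    refine subset_antisymm (sUnion_subset fun U hU => hU.2.2) fun x hx => ?_
    obtain ⟨C, hCc, hCo, hxC, hC⟩ := hzd _ (hO.sdiff hfin.isClosed) x hx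
    exact ⟨C, ⟨hCc, hCo, hC⟩, hxC⟩
  obtain ⟨𝒲, hWp, hWc, hWx⟩ := exists_pointCountable_sUnion hVp fun V hV => by
    obtain ⟨U, ⟨hUc, hUo, hUO⟩, hVU⟩ := hVr V hV
    refine ih (rk t) (hKα t htK) U hUc (fun x hx => ?_) V hVU (hVo V hV)
    have hxK := hOK (hUO hx).1
    refine lt_of_le_of_ne (ht x hxK) fun hxt => (hUO hx).2 ⟨hxK, fun y hy => ?_⟩
    exact hxt ▸ ht y hy
  choose! N hNc hNo hxN hN using hzd O hO
  refine ⟨𝒲 ∪ N '' (O ∩ T), ?_, ?_, fun x => ?_⟩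
  · rintro W (hW | ⟨x, hx, rfl⟩)
    · exact (hWp W hW).1
    · exact ⟨hNc x hx.1, hNo x hx.1⟩
  · rw [sUnion_union, hWc, hunion]
    refine subset_antisymm (union_subset sdiff_subset (sUnion_subset ?_)) fun x hx => ?_
    · rintro _ ⟨x, hx, rfl⟩
      exact hN x hx.1
    · by_cases hxT : x ∈ T
      · exact Or.inr ⟨N x, ⟨x, ⟨hx, hxT⟩, rfl⟩, hxN x hx⟩
      · exact Or.inl ⟨hx, hxT⟩
  · refine ((hWx x).union ((hfin.inter_of_right O).image N).countable).mono ?_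
    rintro W ⟨hW | hW, hxW⟩
    · exact Or.inl ⟨hW, hxW⟩
    · exact Or.inr hW

/-- Every open cover of a hereditarily meta-Lindelöf, locally compact, scattered space has a
point-countable refinement by compact open sets. -/
theorem HereditarilyMetaLindelof.exists_pointCountable_compact_refinement
    {X : Type u} [TopologicalSpace X] [T2Space X] [LocallyCompactSpace X]
    [TotallyDisconnectedSpace X] (hml : HereditarilyMetaLindelof X) {rk : X → Ordinal.{u}}
    (hrk : ∀ x, ∃ U, IsOpen U ∧ x ∈ U ∧ ∀ y ∈ U, y ≠ x → rk y < rk x)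
    {𝒰 : Set (Set X)} (h𝒰 : ∀ U ∈ 𝒰, IsOpen U) :
    ∃ 𝒲 : Set (Set X), (∀ W ∈ 𝒲, IsCompact W ∧ IsOpen W) ∧ ⋃₀ 𝒲 = ⋃₀ 𝒰 ∧
      (∀ W ∈ 𝒲, ∃ U ∈ 𝒰, W ⊆ U) ∧ ∀ x, {W ∈ 𝒲 | x ∈ W}.Countable := by
  obtain ⟨𝒱, hVo, hVc, hVr, hVp⟩ := hml.exists_pointCountable_refinement
    (𝒰 := {C | IsCompact C ∧ IsOpen C ∧ ∃ U ∈ 𝒰, C ⊆ U}) fun C hC => hC.2.1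
  obtain ⟨𝒲, hWp, hWc, hWx⟩ := exists_pointCountable_sUnion hVp fun V hV => by
    obtain ⟨C, ⟨hCc, -, -⟩, hVC⟩ := hVr V hV
    exact hml.exists_pointCountable_compact_cover_of_subset_isCompact hrk
      (Order.succ (⨆ x, rk x)) C hCc (fun x _ => Order.lt_succ_of_le (Ordinal.le_iSup rk x)) V hVC
      (hVo V hV)
  refine ⟨𝒲, fun W hW => (hWp W hW).1, ?_, fun W hW => ?_, hWx⟩
  · rw [hWc, hVc]
    refine subset_antisymm (sUnion_subset ?_) ?_
    · rintro C ⟨-, -, U, hU, hCU⟩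
      exact hCU.trans (subset_sUnion_of_mem hU)
    · rintro x ⟨U, hU, hxU⟩
      obtain ⟨C, hCc, hCo, hxC, hC⟩ := exists_isCompact_isOpen_subset (h𝒰 U hU) hxU
      exact ⟨C, ⟨hCc, hCo, U, hU, hC⟩, hxC⟩
  · obtain ⟨V, hV, hWV⟩ := (hWp W hW).2
    obtain ⟨C, ⟨-, -, U, hU, hCU⟩, hVC⟩ := hVr V hV
    exact ⟨U, hU, hWV.trans (hVC.trans hCU)⟩

/-- Closing off under a countable-valued function of nonempty finite sets does not increase infinite
cardinalities. -/
theorem exists_closure_of_countable {ι : Type u} {F : Finset ι → Set ι}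
    (hF : ∀ s, (F s).Countable) :
    ∃ cl : Set ι → Set ι, Monotone cl ∧ (∀ S, S ⊆ cl S) ∧
      (∀ S (s : Finset ι), (s : Set ι) ⊆ cl S → F s ⊆ cl S) ∧ ∀ S, #(cl S) ≤ max #S ℵ₀ := by
  let step : Set ι → Set ι := fun S => S ∪ ⋃ s : {s : Finset ι // (s : Set ι) ⊆ S}, F s
  have hle : ∀ S, S ⊆ step S := fun S => subset_union_left
  have hmono : Monotone step := fun S T h =>
    union_subset_union h <| iUnion_subset fun s =>
      subset_iUnion (fun s : {s : Finset ι // (s : Set ι) ⊆ T} => F s) ⟨s.1, s.2.trans h⟩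
  have hcard : ∀ S, #(step S) ≤ max #S ℵ₀ := fun S => by
    have hfin : #{s : Finset ι // (s : Set ι) ⊆ S} ≤ max #S ℵ₀ := by
      have hinj : #{s : Finset ι // (s : Set ι) ⊆ S} ≤ #(Finset S) := by
        classical
        refine mk_le_of_injective (f := fun s => s.1.subtype (· ∈ S)) fun s t hst => ?_
        have hs := congrArg (Finset.map (Function.Embedding.subtype (· ∈ S))) hst
        rw [Finset.subtype_map_of_mem fun x hx => s.2 hx,
          Finset.subtype_map_of_mem fun x hx => t.2 hx] at hs
        exact Subtype.ext hs
      refine hinj.trans ?_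
      rcases finite_or_infinite S with hS | hS
      · exact (lt_aleph0_of_finite _).le.trans (le_max_right _ _)
      · exact (mk_finset_of_infinite S).le.trans (le_max_left _ _)
    refine (mk_union_le _ _).trans (add_le_of_le (le_max_right _ _) (le_max_left _ _) ?_)
    refine (mk_iUnion_le _).trans (mul_le_of_le (le_max_right _ _) hfin ?_)
    exact ciSup_le' fun s => (le_aleph0_iff_set_countable.2 (hF s)).trans (le_max_right _ _)
  have hiter : ∀ S, Monotone fun n : ℕ => step^[n] S := fun S =>
    monotone_nat_of_le_succ fun n => by
      rw [Function.iterate_succ_apply']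
      exact hle _
  refine ⟨fun S => ⋃ n : ℕ, step^[n] S, fun S T h => iUnion_mono fun n => hmono.iterate n h,
    fun S => subset_iUnion (fun n : ℕ => step^[n] S) 0, fun S s hs => ?_, fun S => ?_⟩
  · obtain ⟨n, hn⟩ := (hiter S).directed_le.exists_mem_subset_of_finset_subset_biUnion hs
    refine subset_trans ?_ (subset_iUnion (fun n : ℕ => step^[n] S) (n + 1))
    rw [Function.iterate_succ_apply']
    exact (subset_iUnion (fun s : {s : Finset ι // (s : Set ι) ⊆ step^[n] S} => F s)
      ⟨s, hn⟩).trans subset_union_right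
  · have hn : ∀ n : ℕ, #(step^[n] S : Set ι) ≤ max #S ℵ₀ := fun n => by
      induction n with
      | zero => exact le_max_left _ _
      | succ n ih =>
        rw [Function.iterate_succ_apply']
        exact (hcard _).trans (max_le ih (le_max_right _ _))
    have h := mk_iUnion_le_lift fun n : ℕ => step^[n] S
    simp only [Cardinal.lift_uzero, mk_nat, lift_aleph0] at h
    exact h.trans (mul_le_of_le (le_max_right _ _) (le_max_right _ _) (ciSup_le' hn))

/-- A countable family of clopen sets can be made disjoint without changing its union. -/
theorem exists_clopen_shrink_of_countable {X ι : Type*} [TopologicalSpace X] {V : ι → Set X}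
    (hV : ∀ i, IsClopen (V i)) {S : Set ι} (hS : S.Countable) :
    ∃ V' : ι → Set X, (∀ i, IsClopen (V' i) ∧ V' i ⊆ V i) ∧ (⋃ i ∈ S, V i) ⊆ ⋃ i ∈ S, V' i ∧
      ∀ z, {i ∈ S | z ∈ V' i}.Finite := by
  obtain ⟨e, he⟩ := countable_iff_exists_injOn.1 hS
  have hfin : ∀ i, {j ∈ S | e j < e i}.Finite := fun i =>
    Finite.of_finite_image ((finite_Iio (e i)).subset (image_subset_iff.2 fun j hj => hj.2))
      (he.mono fun j hj => hj.1)
  refine ⟨fun i => V i \ ⋃ j ∈ {j ∈ S | e j < e i}, V j, fun i => ⟨?_, sdiff_subset⟩, ?_, ?_⟩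
  · exact (hV i).diff ((hfin i).isClopen_biUnion fun j _ => hV j)
  · intro z hz
    obtain ⟨i, hi, hzi⟩ := mem_iUnion₂.1 hz
    obtain ⟨m, ⟨hm, hzm⟩, hmin⟩ :=
      exists_minimalFor_of_wellFoundedLT (fun i => i ∈ S ∧ z ∈ V i) e ⟨i, hi, hzi⟩
    refine mem_iUnion₂.2 ⟨m, hm, hzm, fun h => ?_⟩
    obtain ⟨j, ⟨hj, hlt⟩, hzj⟩ := mem_iUnion₂.1 h
    exact hlt.not_ge (hmin ⟨hj, hzj⟩ hlt.le)
  · intro z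
    refine Set.Subsingleton.finite fun i hi j hj => he hi.1 hj.1 ?_
    refine le_antisymm (not_lt.1 fun hlt => ?_) (not_lt.1 fun hlt => ?_)
    · exact hi.2.2 (mem_iUnion₂.2 ⟨j, ⟨hj.1, hlt⟩, hj.2.1⟩)
    · exact hj.2.2 (mem_iUnion₂.2 ⟨i, ⟨hi.1, hlt⟩, hi.2.1⟩)

/-- A point-countable family of compact open sets in a scattered space shrinks to a point-finite
family of clopen sets with the same union. -/
theorem exists_pointFinite_clopen_shrink {X ι : Type u} [TopologicalSpace X] [T2Space X]
    {rk : X → Ordinal.{u}}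
    (hrk : ∀ x, ∃ U, IsOpen U ∧ x ∈ U ∧ ∀ y ∈ U, y ≠ x → rk y < rk x)
    {V : ι → Set X} (hVc : ∀ i, IsCompact (V i)) (hVo : ∀ i, IsOpen (V i))
    (hVp : ∀ z, {i | z ∈ V i}.Countable) (S : Set ι) :
    ∃ V' : ι → Set X, (∀ i, IsClopen (V' i) ∧ V' i ⊆ V i) ∧ (⋃ i ∈ S, V i) ⊆ ⋃ i ∈ S, V' i ∧
      ∀ z, {i ∈ S | z ∈ V' i}.Finite := by
  have hVcl : ∀ i, IsClopen (V i) := fun i => ⟨(hVc i).isClosed, hVo i⟩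
  have hKc : ∀ s : Finset ι, s.Nonempty → IsCompact (⋂ i ∈ s, V i) := fun s ⟨i, hi⟩ =>
    (hVc i).of_isClosed_subset (isClosed_biInter fun i _ => (hVc i).isClosed)
      (biInter_subset_of_mem hi)
  -- the indices of the sets containing a point of maximal rank of a finite intersection
  let F : Finset ι → Set ι := fun s => {j | s.Nonempty ∧
    ∃ t ∈ {x ∈ ⋂ i ∈ s, V i | ∀ y ∈ ⋂ i ∈ s, V i, rk y ≤ rk x}, t ∈ V j}
  have hF : ∀ s, (F s).Countable := fun s => by
    rcases s.eq_empty_or_nonempty with rfl | hs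
    · simp [F]
    · refine (((hKc s hs).finite_setOf_max_rank hrk).1.countable.biUnion fun t _ => hVp t).mono ?_
      rintro j ⟨-, t, ht, htj⟩
      exact mem_iUnion₂.2 ⟨t, ht, htj⟩
  obtain ⟨cl, hclm, hcl, hclF, hclc⟩ := exists_closure_of_countable hF
  induction hκ : #S using WellFoundedLT.induction generalizing S with
  | ind κ ih =>
  subst hκ
  by_cases hS : S.Countable
  · exact exists_clopen_shrink_of_countable hVcl hS
  have hS' : ℵ₀ < #S := not_le.1 fun h => hS (le_aleph0_iff_set_countable.1 h)
  obtain ⟨_, _, hr⟩ := exists_ord_eq_type_lt S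
  let A : S → Set ι := fun w => cl ((↑) '' Iic w)
  have hA : Monotone A := fun v w h => hclm (image_mono (Iic_subset_Iic.2 h))
  have hAc : ∀ w, #(A w) < #S := fun w => by
    refine (hclc _).trans_lt (max_lt (mk_image_le.trans_lt ?_) hS')
    rw [← Iio_insert]
    exact (mk_insert_le).trans_lt (add_lt_of_lt hS'.le (mk_Iio_lt w hr) (one_lt_aleph0.trans hS'))
  have hmem : ∀ i : S, ∃ w, (i : ι) ∈ A w ∧ ∀ v, (i : ι) ∈ A v → w ≤ v := fun i => by
    obtain ⟨w, hw, hmin⟩ := WellFounded.has_min (wellFounded_lt (α := S)) {w | (i : ι) ∈ A w}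
      ⟨i, hcl _ ⟨i, le_rfl, rfl⟩⟩
    exact ⟨w, hw, fun v hv => not_lt.1 (hmin v hv)⟩
  choose ρ hρA hρ using hmem
  choose W hW hWc hWf using fun w : S => ih #((↑) '' (ρ ⁻¹' {w}) : Set ι)
    ((mk_le_mk_of_subset (by rintro _ ⟨i, rfl, rfl⟩; exact hρA i)).trans_lt (hAc w)) _ rfl
  classical
  obtain ⟨V', hV', hV'e⟩ : ∃ V' : ι → Set X,
      (∀ i : S, V' i = W (ρ i) i) ∧ ∀ i ∉ S, V' i = ∅ :=
    ⟨fun i => if h : i ∈ S then W (ρ ⟨i, h⟩) i else ∅, fun i => dif_pos i.2, fun i hi => dif_neg hi⟩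
  refine ⟨V', fun i => ?_, ?_, fun z => ?_⟩
  · by_cases h : i ∈ S
    · exact hV' ⟨i, h⟩ ▸ hW _ i
    · exact hV'e i h ▸ ⟨isClopen_empty, empty_subset _⟩
  · intro z hz
    obtain ⟨i, hi, hzi⟩ := mem_iUnion₂.1 hz
    obtain ⟨_, ⟨j, hj, rfl⟩, hzj⟩ := mem_iUnion₂.1
      (hWc (ρ ⟨i, hi⟩) (mem_iUnion₂.2 ⟨i, ⟨⟨i, hi⟩, rfl, rfl⟩, hzi⟩))
    refine mem_iUnion₂.2 ⟨j, j.2, ?_⟩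
    rw [hV' j]
    exact (show ρ j = _ from hj) ▸ hzj
  -- the levels met by a finite intersection are bounded by induction on its rank
  have key : ∀ α, ∀ s : Finset S, s.Nonempty → (∀ i ∈ s, z ∈ V i) →
      (∀ y, (∀ i ∈ s, y ∈ V i) → rk y < α) →
      {w | (∃ j : S, z ∈ V j ∧ ρ j = w) ∧ ∀ i ∈ s, ρ i < w}.Finite := by
    intro α
    induction α using WellFoundedLT.induction with
    | ind α ihα =>
    intro s hs hzs hα
    rcases eq_empty_or_nonempty {w | (∃ j : S, z ∈ V j ∧ ρ j = w) ∧ ∀ i ∈ s, ρ i < w} with h | hne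
    · rw [h]
      exact finite_empty
    obtain ⟨w, ⟨⟨j, hzj, rfl⟩, hjs⟩, hmin⟩ := WellFounded.has_min (wellFounded_lt (α := S)) _ hne
    let s' : Finset ι := s.map (Function.Embedding.subtype _)
    have hs' : s'.Nonempty := hs.map
    have hKs : ∀ y, y ∈ ⋂ i ∈ s', V i ↔ ∀ i ∈ s, y ∈ V i := fun y => by simp [s']
    obtain ⟨t, ht⟩ := ((hKc s' hs').finite_setOf_max_rank hrk).2 ⟨z, (hKs z).2 hzs⟩
    obtain ⟨m, hms, hm⟩ := s.exists_max_image ρ hs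
    have hsA : (s' : Set ι) ⊆ A (ρ m) := by
      intro i hi
      obtain ⟨i, his, rfl⟩ := Finset.mem_map.1 hi
      exact hA (hm i his) (hρA i)
    have hnot : ∀ y ∈ {x ∈ ⋂ i ∈ s', V i | ∀ y ∈ ⋂ i ∈ s', V i, rk y ≤ rk x}, y ∉ V j :=
      fun y hy hyj => (hjs m hms).not_ge (hρ j _ (hclF _ s' hsA ⟨hs', y, hy, hyj⟩))
    refine ((ihα (rk t) (hα t ((hKs t).1 ht.1)) (insert j s) (Finset.insert_nonempty _ _)
      (Finset.forall_mem_insert _ _ _ |>.2 ⟨hzj, hzs⟩) fun y hy => ?_).insert (ρ j)).subset ?_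
    · rw [Finset.forall_mem_insert] at hy
      have hys := (hKs y).2 hy.2
      exact not_le.1 fun hle => hnot y ⟨hys, fun x hx => (ht.2 x hx).trans hle⟩ hy.1
    · rintro w ⟨hw, hws⟩
      rcases (not_lt.1 (hmin w ⟨hw, hws⟩)).eq_or_lt with h | h
      · exact Or.inl h.symm
      · exact Or.inr ⟨hw, Finset.forall_mem_insert _ _ _ |>.2 ⟨h, hws⟩⟩
  have hlev : {w | ∃ j : S, z ∈ V j ∧ ρ j = w}.Finite := by
    rcases eq_empty_or_nonempty {w | ∃ j : S, z ∈ V j ∧ ρ j = w} with h | hne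
    · rw [h]
      exact finite_empty
    obtain ⟨w, ⟨j, hzj, rfl⟩, hmin⟩ := WellFounded.has_min (wellFounded_lt (α := S)) _ hne
    refine ((key (Order.succ (⨆ x, rk x)) {j} (Finset.singleton_nonempty j) (by simpa using hzj)
      fun y _ => Order.lt_succ_of_le (Ordinal.le_iSup rk y)).insert (ρ j)).subset fun w hw => ?_
    rcases (not_lt.1 (hmin w hw)).eq_or_lt with h | h
    · exact Or.inl h.symm
    · exact Or.inr ⟨hw, by simpa using h⟩
  refine (hlev.biUnion fun w _ => hWf w z).subset ?_
  rintro i ⟨hi, hzi⟩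
  rw [hV' ⟨i, hi⟩] at hzi
  exact mem_iUnion₂.2 ⟨ρ ⟨i, hi⟩, ⟨⟨i, hi⟩, (hW _ i).2 hzi, rfl⟩, ⟨⟨i, hi⟩, rfl, rfl⟩, hzi⟩

/-- Every open cover of a hereditarily meta-Lindelöf, locally compact, scattered
Tychonoff space of countable Cantor–Bendixson height has a point-finite clopen
refinement. -/
theorem open_cover_has_pointFinite_clopen_refinement_of_countable_height
    (X : Type u) [TopologicalSpace X] [T35Space X] [LocallyCompactSpace X]
    (hml : HereditarilyMetaLindelof X) (hsc : IsScattered X)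
    (hht : cbHeight X < ω₁)
    (𝒰 : Set (Set X)) (hopen : ∀ U ∈ 𝒰, IsOpen U) (hcov : ⋃₀ 𝒰 = Set.univ) :
    ∃ 𝒱 : Set (Set X), (∀ V ∈ 𝒱, IsClopen V) ∧ ⋃₀ 𝒱 = Set.univ ∧
      (∀ V ∈ 𝒱, ∃ U ∈ 𝒰, V ⊆ U) ∧ ∀ x : X, {V ∈ 𝒱 | x ∈ V}.Finite := by
  obtain ⟨rk, hrk⟩ := hsc.exists_rank
  have := hsc.totallyDisconnectedSpace
  obtain ⟨𝒲, hWp, hWc, hWr, hWx⟩ := hml.exists_pointCountable_compact_refinement hrk hopen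
  obtain ⟨V', hV, hVc, hVf⟩ := exists_pointFinite_clopen_shrink hrk (V := ((↑) : 𝒲 → Set X))
    (fun W => (hWp W W.2).1) (fun W => (hWp W W.2).2)
    (fun z => ((hWx z).preimage Subtype.val_injective).mono fun W hW => And.intro W.2 hW) univ
  refine ⟨range V', ?_, ?_, ?_, fun x => ?_⟩
  · rintro _ ⟨W, rfl⟩
    exact (hV W).1
  · refine eq_univ_of_forall fun x => ?_
    obtain ⟨W, hW, hxW⟩ := (hWc.trans hcov).symm.subset (mem_univ x)
    obtain ⟨W', -, hxW'⟩ := mem_iUnion₂.1 <| hVc <|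
      mem_iUnion₂.2 ⟨⟨W, hW⟩, mem_univ _, hxW⟩
    exact ⟨_, ⟨W', rfl⟩, hxW'⟩
  · rintro _ ⟨W, rfl⟩
    obtain ⟨U, hU, hWU⟩ := hWr W W.2
    exact ⟨U, hU, (hV W).2.trans hWU⟩
  · refine ((hVf x).image V').subset ?_
    rintro _ ⟨⟨W, rfl⟩, hx⟩
    exact ⟨W, ⟨mem_univ _, hx⟩, rfl⟩
end
end

section
/- Every scattered, hereditarily meta-Lindelöf, locally countable topological space is σ-discrete. -/
open Set Topology Ordinal Cardinal

noncomputable section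
universe u

theorem IsMetaLindelof.of_homeomorph {X Y : Type*} [TopologicalSpace X] [TopologicalSpace Y]
    (e : X ≃ₜ Y) (h : IsMetaLindelof X) : IsMetaLindelof Y := by
  intro 𝒰 hopen hcov
  obtain ⟨𝒱, hVo, hVc, hVr, hVp⟩ := h ((fun U => e ⁻¹' U) '' 𝒰)
    (by rintro _ ⟨U, hU, rfl⟩; exact (hopen U hU).preimage e.continuous)
    (by
      refine eq_univ_of_forall fun x => ?_
      obtain ⟨U, hU, hx⟩ : e x ∈ ⋃₀ 𝒰 := hcov ▸ mem_univ _
      exact ⟨_, ⟨U, hU, rfl⟩, hx⟩)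
  refine ⟨(fun V => e '' V) '' 𝒱, ?_, ?_, ?_, fun y => ?_⟩
  · rintro _ ⟨V, hV, rfl⟩
    exact e.isOpenMap V (hVo V hV)
  · refine eq_univ_of_forall fun y => ?_
    obtain ⟨V, hV, hy⟩ : e.symm y ∈ ⋃₀ 𝒱 := hVc ▸ mem_univ _
    exact ⟨_, ⟨V, hV, rfl⟩, _, hy, e.apply_symm_apply y⟩
  · rintro _ ⟨V, hV, rfl⟩
    obtain ⟨_, ⟨U, hU, rfl⟩, hVU⟩ := hVr V hV
    exact ⟨U, hU, image_subset_iff.2 hVU⟩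
  · refine ((hVp (e.symm y)).image (fun V => e '' V)).mono ?_
    rintro _ ⟨⟨V, hV, rfl⟩, x, hx, rfl⟩
    exact ⟨V, ⟨hV, by simpa using hx⟩, rfl⟩

theorem HereditarilyMetaLindelof.isMetaLindelof {X : Type*} [TopologicalSpace X]
    (h : HereditarilyMetaLindelof X) : IsMetaLindelof X :=
  (h univ).of_homeomorph (Homeomorph.Set.univ X)

theorem countable_setOf_reflTransGen {α : Type*} {r : α → α → Prop}
    (h : ∀ a, {b | r a b}.Countable) (a : α) :
    {b | Relation.ReflTransGen r a b}.Countable := by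
  let S : ℕ → Set α := fun n => Nat.rec {a} (fun _ T => ⋃ b ∈ T, {c | r b c}) n
  have hS : ∀ n, (S n).Countable := by
    intro n
    induction n with
    | zero => exact countable_singleton a
    | succ n ih => exact ih.biUnion fun b _ => h b
  refine (countable_iUnion hS).mono fun b hb => ?_
  induction hb with
  | refl => exact mem_iUnion.2 ⟨0, rfl⟩
  | tail _ hbc ih =>
    obtain ⟨n, hn⟩ := mem_iUnion.1 ih
    exact mem_iUnion.2 ⟨n + 1, mem_biUnion hn hbc⟩

/-- A locally countable meta-Lindelöf space is partitioned into countable open sets. -/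
theorem IsMetaLindelof.exists_setoid_isOpen_countable {X : Type*} [TopologicalSpace X]
    (hml : IsMetaLindelof X) (hlc : LocallyCountable X) :
    ∃ s : Setoid X, ∀ x, IsOpen {y | s x y} ∧ {y | s x y}.Countable := by
  obtain ⟨𝒱, hVo, hVc, hVr, hVp⟩ := hml {U | IsOpen U ∧ U.Countable} (fun U hU => hU.1)
    (eq_univ_of_forall fun x =>
      let ⟨U, hUo, hxU, hUc⟩ := hlc x
      ⟨U, ⟨hUo, hUc⟩, hxU⟩)
  let r : X → X → Prop := fun x y => ∃ V ∈ 𝒱, x ∈ V ∧ y ∈ V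
  have hsymm : Std.Symm r := ⟨fun x y ⟨V, hV, hx, hy⟩ => ⟨V, hV, hy, hx⟩⟩
  refine ⟨⟨Relation.ReflTransGen r, fun _ => .refl, fun h => symm h,
    fun h h' => h.trans h'⟩, fun x => ⟨isOpen_iff_mem_nhds.2 fun y hy => ?_, ?_⟩⟩
  · obtain ⟨V, hV, hyV⟩ : y ∈ ⋃₀ 𝒱 := hVc ▸ mem_univ _
    exact Filter.mem_of_superset ((hVo V hV).mem_nhds hyV)
      fun z hz => Relation.ReflTransGen.tail hy ⟨V, hV, hyV, hz⟩
  · refine countable_setOf_reflTransGen (fun a => ?_) x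
    refine ((hVp a).biUnion (t := fun V _ => V) fun V hV => ?_).mono ?_
    · obtain ⟨U, hU, hVU⟩ := hVr V hV.1
      exact hU.2.mono hVU
    · rintro b ⟨V, hV, ha, hb⟩
      exact mem_biUnion (show V ∈ {V ∈ 𝒱 | a ∈ V} from ⟨hV, ha⟩) hb

theorem IsSigmaDiscrete.of_setoid {X : Type*} [TopologicalSpace X] (s : Setoid X)
    (hs : ∀ x, IsOpen {y | s x y} ∧ {y | s x y}.Countable) : IsSigmaDiscrete X := by
  have hinj : ∀ q : Quotient s, ∃ f : X → ℕ, InjOn f {y | Quotient.mk s y = q} := by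
    intro q
    induction q using Quotient.inductionOn with
    | h x =>
      refine countable_iff_exists_injOn.1 ((hs x).2.mono fun y hy => ?_)
      exact s.symm (Quotient.exact hy)
  choose f hf using hinj
  refine ⟨fun n => {x | f (Quotient.mk s x) x = n},
    eq_univ_of_forall fun x => mem_iUnion.2 ⟨_, rfl⟩, fun n => ?_⟩
  refine discreteTopology_iff_isOpen_singleton.2 fun x => ?_
  refine isOpen_induced_iff.2 ⟨{y | s x y}, (hs x).1, ?_⟩
  ext y
  refine ⟨fun hy => ?_, fun hy => ?_⟩
  · have hq : Quotient.mk s y.1 = Quotient.mk s x.1 := Quotient.sound (s.symm hy)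
    refine Subtype.ext (hf _ hq rfl ?_)
    rw [x.2.out, ← hq, y.2.out]
  · rw [mem_singleton_iff.1 hy]
    exact s.refl x.1

/-- Every scattered, hereditarily meta-Lindelöf, locally countable topological space is
σ-discrete. -/
theorem sigmaDiscrete_of_scattered_heredMetaLindelof_locallyCountable
    (X : Type u) [TopologicalSpace X]
    (hsc : IsScattered X) (hml : HereditarilyMetaLindelof X)
    (hlc : LocallyCountable X) :
    IsSigmaDiscrete X := by
  obtain ⟨s, hs⟩ := hml.isMetaLindelof.exists_setoid_isOpen_countable hlc
  exact .of_setoid s hs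
end
end

section
/- Every Eberlein–Grothendieck, locally countable, scattered space of cardinality ω₁ is σ-discrete. -/
open Set Topology Ordinal Cardinal

noncomputable section
universe u

/-- A space with a point-countable open cover by countable sets is σ-discrete: chains of members
of the cover split it into countable clopen pieces. -/
theorem isSigmaDiscrete_of_pointCountable_cover {X ι : Type*} [TopologicalSpace X]
    (V : ι → Set X) (hopen : ∀ i, IsOpen (V i)) (hcount : ∀ i, (V i).Countable)
    (hcover : ∀ x, ∃ i, x ∈ V i) (hpc : ∀ x, {i | x ∈ V i}.Countable) :
    IsSigmaDiscrete X := by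
  classical
  let R : X → X → Prop := fun x y => ∃ i, x ∈ V i ∧ y ∈ V i
  let C : X → Set X := fun x => {y | Relation.ReflTransGen R x y}
  have : Std.Symm R := ⟨fun _ _ ⟨i, hx, hy⟩ => ⟨i, hy, hx⟩⟩
  have hsymm : ∀ {x y}, Relation.ReflTransGen R x y → Relation.ReflTransGen R y x :=
    fun h => symm h
  have hCeq : ∀ {x y}, y ∈ C x → C y = C x := fun {x y} h => by
    ext z
    exact ⟨fun hz => Relation.ReflTransGen.trans h hz,
      fun hz => Relation.ReflTransGen.trans (hsymm h) hz⟩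
  have hCopen : ∀ x, IsOpen (C x) := fun x => by
    rw [isOpen_iff_forall_mem_open]
    intro y hy
    obtain ⟨i, hi⟩ := hcover y
    exact ⟨V i, fun z hz => Relation.ReflTransGen.tail hy ⟨i, hi, hz⟩, hopen i, hi⟩
  let step : Set X → Set X := fun S => ⋃ y ∈ S, ⋃ i ∈ {i | y ∈ V i}, V i
  have hstep : ∀ S : Set X, S.Countable → (step S).Countable := fun S hS =>
    hS.biUnion fun y _ => (hpc y).biUnion fun i _ => hcount i
  have hCcount : ∀ x, (C x).Countable := fun x => by
    have hit : ∀ n, (step^[n] {x}).Countable := fun n => by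
      induction n with
      | zero => exact Set.countable_singleton x
      | succ n ih => rw [Function.iterate_succ_apply']; exact hstep _ ih
    refine (Set.countable_iUnion hit).mono fun y hy => ?_
    induction hy with
    | refl => exact Set.mem_iUnion.2 ⟨0, rfl⟩
    | tail _ h ih =>
      obtain ⟨n, hn⟩ := Set.mem_iUnion.1 ih
      obtain ⟨i, hb, hc⟩ := h
      refine Set.mem_iUnion.2 ⟨n + 1, ?_⟩
      rw [Function.iterate_succ_apply']
      exact Set.mem_biUnion hn (Set.mem_biUnion (show i ∈ {i | _ ∈ V i} from hb) hc)
  have hinj : ∀ S : Set X, ∃ e : X → ℕ, S.Countable → Set.InjOn e S := fun S => by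
    by_cases hS : S.Countable
    · obtain ⟨e, he⟩ := Set.countable_iff_exists_injOn.1 hS
      exact ⟨e, fun _ => he⟩
    · exact ⟨fun _ => 0, fun h => absurd h hS⟩
  choose e he using hinj
  refine ⟨fun n => {x | e (C x) x = n}, ?_, fun n => ?_⟩
  · ext x
    simp
  · rw [discreteTopology_subtype_iff']
    intro x hx
    refine ⟨C x, hCopen x, ?_⟩
    ext y
    constructor
    · rintro ⟨hy, hyn⟩
      refine he (C x) (hCcount x) hy Relation.ReflTransGen.refl ?_
      have h : e (C y) y = n := hyn
      rw [hCeq hy] at h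
      exact h.trans (Eq.symm hx)
    · rintro rfl
      exact ⟨Relation.ReflTransGen.refl, hx⟩

/-- Stone–Weierstrass without separation of points: a function constant on the common fibres of
`Z` lies in the closed subalgebra generated by `Z`. -/
theorem mem_closure_adjoin_of_forall_eq {K : Type*} [TopologicalSpace K] [CompactSpace K]
    (Z : Set C(K, ℝ)) (f : C(K, ℝ))
    (hf : ∀ s t, (∀ z ∈ Z, z s = z t) → f s = f t) :
    f ∈ closure (Algebra.adjoin ℝ Z : Set C(K, ℝ)) := by
  let p : K → (Z → ℝ) := fun s z => z.1 s
  have hp : Continuous p := continuous_pi fun z => z.1.continuous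
  let L := Set.range p
  let π : C(K, L) := ⟨Set.rangeFactorization p, hp.subtype_mk _⟩
  have hsurj : Function.Surjective π := Set.rangeFactorization_surjective
  have hcompact : CompactSpace L := isCompact_iff_compactSpace.1 (isCompact_range hp)
  have hquot : IsQuotientMap π := π.continuous.isClosedMap.isQuotientMap π.continuous hsurj
  have hfib : ∀ s t, π s = π t → f s = f t := fun s t h => hf s t fun z hz =>
    congrFun (congrArg Subtype.val h) ⟨z, hz⟩
  let g : C(L, ℝ) := hquot.lift f hfib
  have hg : g.comp π = f := hquot.lift_comp f hfib
  let coord : Z → C(L, ℝ) := fun z => ⟨fun l => l.1 z, (continuous_apply z).comp continuous_subtype_val⟩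
  have hsep : (Algebra.adjoin ℝ (Set.range coord)).SeparatesPoints := by
    intro l m hlm
    have : ∃ z, l.1 z ≠ m.1 z := by
      by_contra! h
      exact hlm (Subtype.ext (funext h))
    obtain ⟨z, hz⟩ := this
    exact ⟨coord z, ⟨coord z, Algebra.subset_adjoin ⟨z, rfl⟩, rfl⟩, hz⟩
  have htop := ContinuousMap.subalgebra_topologicalClosure_eq_top_of_separatesPoints _ hsep
  have hgmem : g ∈ closure (Algebra.adjoin ℝ (Set.range coord) : Set C(L, ℝ)) := by
    rw [← Subalgebra.topologicalClosure_coe, htop]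
    trivial
  let Φ : C(L, ℝ) →ₐ[ℝ] C(K, ℝ) := ContinuousMap.compRightAlgHom ℝ ℝ π
  have hΦ : Continuous Φ := ContinuousMap.continuous_precomp π
  have hmaps : Set.MapsTo Φ (Algebra.adjoin ℝ (Set.range coord) : Set C(L, ℝ))
      (Algebra.adjoin ℝ Z : Set C(K, ℝ)) := by
    intro h hh
    have hmem : Φ h ∈ (Algebra.adjoin ℝ (Set.range coord)).map Φ := ⟨h, hh, rfl⟩
    rw [AlgHom.map_adjoin] at hmem
    refine Algebra.adjoin_mono ?_ hmem
    rintro _ ⟨_, ⟨z, rfl⟩, rfl⟩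
    exact z.2
  have := map_mem_closure hΦ hgmem hmaps
  rwa [show Φ g = f from hg] at this

/-- The subalgebra generated by a countable set is separable. -/
theorem isSeparable_adjoin {A : Type*} [CommRing A] [Algebra ℝ A] [TopologicalSpace A]
    [ContinuousAdd A] [ContinuousSMul ℝ A] {Z : Set A} (hZ : Z.Countable) :
    TopologicalSpace.IsSeparable (Algebra.adjoin ℝ Z : Set A) := by
  have hcl : (Submonoid.closure Z : Set A).Countable := by
    have := hZ.to_subtype
    rw [Submonoid.closure_eq_mrange, MonoidHom.coe_mrange]
    exact Set.countable_range _
  have h := hcl.isSeparable.span (R := ℝ)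
  rwa [← Algebra.adjoin_eq_span] at h

/-- An element of the subalgebra generated by the terms before `y` already lies in the
subalgebra generated by an earlier initial segment. -/
theorem exists_lt_mem_adjoin_Iic {X A : Type*} [LinearOrder X] [CommRing A] [Algebra ℝ A]
    (F : X → A) {y : X} (hy : ∃ z, z < y) {f : A}
    (hf : f ∈ Algebra.adjoin ℝ (F '' Set.Iio y)) :
    ∃ z < y, f ∈ Algebra.adjoin ℝ (F '' Set.Iic z) := by
  have mono : ∀ {z w : X}, z ≤ w →
      Algebra.adjoin ℝ (F '' Set.Iic z) ≤ Algebra.adjoin ℝ (F '' Set.Iic w) :=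
    fun h => Algebra.adjoin_mono (Set.image_mono (Set.Iic_subset_Iic.2 h))
  induction hf using Algebra.adjoin_induction with
  | mem g hg =>
    obtain ⟨z, hz, rfl⟩ := hg
    exact ⟨z, hz, Algebra.subset_adjoin ⟨z, le_rfl, rfl⟩⟩
  | algebraMap r =>
    obtain ⟨z, hz⟩ := hy
    exact ⟨z, hz, Subalgebra.algebraMap_mem _ r⟩
  | add g h _ _ ihg ihh =>
    obtain ⟨z, hz, hgz⟩ := ihg
    obtain ⟨w, hw, hhw⟩ := ihh
    exact ⟨max z w, max_lt hz hw,
      add_mem (mono (le_max_left _ _) hgz) (mono (le_max_right _ _) hhw)⟩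
  | mul g h _ _ ihg ihh =>
    obtain ⟨z, hz, hgz⟩ := ihg
    obtain ⟨w, hw, hhw⟩ := ihh
    exact ⟨max z w, max_lt hz hw,
      mul_mem (mono (le_max_left _ _) hgz) (mono (le_max_right _ _) hhw)⟩

/-- A basic neighbourhood in a space carrying a topology of pointwise convergence. -/
theorem exists_finset_of_isInducing_pointwise {X K : Type*} [TopologicalSpace X]
    {F : X → K → ℝ} (hF : IsInducing F) {U : Set X} (hU : IsOpen U) {x : X} (hx : x ∈ U) :
    ∃ (k : Finset K) (ε : ℝ), 0 < ε ∧ {w | ∀ s ∈ k, |F w s - F x s| < ε} ⊆ U := by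
  obtain ⟨W, hW, rfl⟩ := hF.isOpen_iff.1 hU
  obtain ⟨k, u, hu, hsub⟩ := isOpen_pi_iff.1 hW (F x) hx
  have hball : ∀ s : K, ∃ ε : ℝ, 0 < ε ∧ (s ∈ k → Metric.ball (F x s) ε ⊆ u s) := fun s => by
    by_cases hs : s ∈ k
    · obtain ⟨ε, hε, h⟩ := Metric.isOpen_iff.1 (hu s hs).1 _ (hu s hs).2
      exact ⟨ε, hε, fun _ => h⟩
    · exact ⟨1, one_pos, fun h => absurd h hs⟩
  choose ε hε hεu using hball
  have hmin : ∃ η : ℝ, 0 < η ∧ ∀ s ∈ k, η ≤ ε s := by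
    rcases k.eq_empty_or_nonempty with rfl | hne
    · exact ⟨1, one_pos, by simp⟩
    · exact ⟨k.inf' hne ε, (Finset.lt_inf'_iff hne).2 fun s _ => hε s,
        fun s hs => Finset.inf'_le ε hs⟩
  obtain ⟨η, hη, hle⟩ := hmin
  refine ⟨k, η, hη, fun w hw => hsub fun s hs => hεu s hs ?_⟩
  rw [Metric.mem_ball, Real.dist_eq]
  exact (hw s hs).trans_le (hle s hs)

/-- A set of continuous functions on a compact space, well-ordered with countable initial
segments, is meta-Lindelöf in the topology of pointwise convergence. -/
theorem exists_pointCountable_refinement {X K : Type*} [TopologicalSpace X] [LinearOrder X]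
    [WellFoundedLT X] [TopologicalSpace K] [CompactSpace K] (hX : ∀ y : X, (Set.Iic y).Countable)
    (F : X → C(K, ℝ)) (hF : IsInducing fun x => (F x : K → ℝ))
    (U : X → Set X) (hU : ∀ x, IsOpen (U x)) (hxU : ∀ x, x ∈ U x) :
    ∃ V : X × C(K, ℝ) × ℕ → Set X, (∀ i, IsOpen (V i)) ∧ (∀ i, ∃ z, V i ⊆ U z) ∧
      (∀ x, ∃ i, x ∈ V i) ∧ ∀ x, {i | x ∈ V i}.Countable := by
  have heval : ∀ s, Continuous fun w => F w s := fun s =>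
    (continuous_apply s).comp hF.continuous
  let B : X → Set X := fun y =>
    {w | (∃ z, z < y) ∧ ∀ s t, (∀ z < y, F z s = F z t) → F w s = F w t}
  have hB : ∀ y, IsClosed (B y) := fun y => by
    refine isClosed_const.inter ?_
    change IsClosed {w | ∀ s t, (∀ z < y, F z s = F z t) → F w s = F w t}
    simp only [Set.ofPred_forall]
    exact isClosed_iInter fun s => isClosed_iInter fun t => isClosed_iInter fun _ =>
      isClosed_eq (heval s) (heval t)
  choose D hDc hD using fun y : X => isSeparable_adjoin ((hX y).image F)
  let N : C(K, ℝ) → ℕ → Finset K → Set X := fun a n k =>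
    {w | ∀ s ∈ k, |F w s - a s| < 2 * (1 / ((n : ℝ) + 1))}
  have hN : ∀ a n k, IsOpen (N a n k) := fun a n k => by
    simp only [N, Set.ofPred_forall]
    exact isOpen_biInter_finset fun s _ =>
      isOpen_lt ((heval s).sub continuous_const).abs continuous_const
  have hk : ∀ a n, ∃ k, (∃ k' z, N a n k' ⊆ U z) → ∃ z, N a n k ⊆ U z := fun a n => by
    by_cases h : ∃ k' z, N a n k' ⊆ U z
    · exact ⟨h.choose, fun _ => h.choose_spec⟩
    · exact ⟨∅, fun h' => absurd h' h⟩
  choose k hk using hk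
  refine ⟨fun i => {w | (i.2.1 ∈ D i.1 ∧ ∃ z, N i.2.1 i.2.2 (k i.2.1 i.2.2) ⊆ U z) ∧
    w ∈ N i.2.1 i.2.2 (k i.2.1 i.2.2) ∧ w ∉ B i.1}, ?_, ?_, ?_, ?_⟩
  · intro i
    exact isOpen_const.inter ((hN _ _ _).inter (hB i.1).isOpen_compl)
  · rintro ⟨y, a, n⟩
    by_cases h : ∃ z, N a n (k a n) ⊆ U z
    · obtain ⟨z, hz⟩ := h
      exact ⟨z, fun w hw => hz hw.2.1⟩
    · exact ⟨y, fun w hw => absurd hw.1.2 h⟩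
  · intro x
    obtain ⟨k₀, ε, hε, hsub⟩ := exists_finset_of_isInducing_pointwise hF (hU x) (hxU x)
    obtain ⟨n, hn⟩ := exists_nat_one_div_lt (show (0 : ℝ) < ε / 3 by positivity)
    have hr : (0 : ℝ) < 1 / ((n : ℝ) + 1) := by positivity
    let S : Set X := {y | ∃ f ∈ Algebra.adjoin ℝ (F '' Set.Iic y), dist (F x) f < 1 / ((n : ℝ) + 1)}
    have hS : S.Nonempty := ⟨x, F x, Algebra.subset_adjoin ⟨x, le_rfl, rfl⟩, by simpa using hr⟩
    obtain ⟨y, ⟨f, hf, hfx⟩, hmin⟩ := WellFounded.has_min (wellFounded_lt (α := X)) S hS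
    obtain ⟨a, haD, ha⟩ := Metric.mem_closure_iff.1 (hD y hf) _ (sub_pos.2 hfx)
    have hxa : dist (F x) a < 1 / ((n : ℝ) + 1) := by
      linarith [dist_triangle (F x) f a]
    have hpt : ∀ s, |F x s - a s| < 1 / ((n : ℝ) + 1) := fun s => by
      rw [← Real.dist_eq]
      exact (ContinuousMap.dist_apply_le_dist s).trans_lt hxa
    refine ⟨(y, a, n), ⟨haD, hk a n ⟨k₀, x, fun w hw => hsub fun s hs => ?_⟩⟩,
      fun s _ => ?_, ?_⟩
    · have h₁ : |F w s - a s| < _ := hw s hs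
      have h₂ := hpt s
      rw [abs_lt] at h₁ h₂ ⊢
      constructor <;> linarith
    · linarith [hpt s]
    · rintro ⟨hy, hfib⟩
      have hcl : F x ∈ closure (Algebra.adjoin ℝ (F '' Set.Iio y) : Set C(K, ℝ)) :=
        mem_closure_adjoin_of_forall_eq _ _ fun s t h =>
          hfib s t fun z hz => h _ ⟨z, hz, rfl⟩
      obtain ⟨g, hg, hgx⟩ := Metric.mem_closure_iff.1 hcl _ hr
      obtain ⟨z, hzy, hz⟩ := exists_lt_mem_adjoin_Iic F hy hg
      exact hmin z ⟨g, hz, hgx⟩ hzy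
  · intro x
    have hcount : (⋃ y ∈ Set.Iic x, (fun p : C(K, ℝ) × ℕ => (y, p)) ''
        (D y ×ˢ (Set.univ : Set ℕ))).Countable :=
      (hX x).biUnion fun y _ => ((hDc y).prod Set.countable_univ).image _
    refine hcount.mono ?_
    rintro ⟨y, a, n⟩ ⟨⟨haD, _⟩, _, hxB⟩
    have hyx : y ≤ x := by
      by_contra! h
      exact hxB ⟨⟨x, h⟩, fun s t hst => hst x h⟩
    exact Set.mem_biUnion (show y ∈ Set.Iic x from hyx) ⟨(a, n), ⟨haD, trivial⟩, rfl⟩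

/-- A type of cardinality `ℵ₁` has a well-order with countable initial segments. -/
theorem exists_wellOrder_countable_Iic {X : Type*} (hX : #X = Cardinal.aleph 1) :
    ∃ (_ : LinearOrder X) (_ : WellFoundedLT X), ∀ y : X, (Set.Iic y).Countable := by
  obtain ⟨o, hwf, hord⟩ := Cardinal.exists_ord_eq_type_lt X
  refine ⟨o, hwf, fun y => ?_⟩
  have h : #(Set.Iic y) < #X := mk_Iic_lt y hord (by rw [hX]; exact aleph0_le_aleph 1)
  rwa [hX, ← succ_aleph0, Order.lt_succ_iff, le_aleph0_iff_set_countable] at h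

/-- Every Eberlein–Grothendieck, locally countable, scattered space of cardinality `ω₁`
is σ-discrete. -/
theorem sigmaDiscrete_of_EG_locallyCountable_scattered
    (X : Type u) [TopologicalSpace X]
    (hEG : EberleinGrothendieck X) (hlc : LocallyCountable X)
    (hsc : IsScattered X) (hcard : #X = Cardinal.aleph 1) :
    IsSigmaDiscrete X := by
  obtain ⟨K, _, _, _, f, hf⟩ := hEG
  obtain ⟨_, _, hIic⟩ := exists_wellOrder_countable_Iic hcard
  choose U hU hxU hUc using hlc
  let F : X → C(K, ℝ) := fun x => ⟨(f x).1, (f x).2⟩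
  have hF : IsInducing fun x => (F x : K → ℝ) := IsInducing.subtypeVal.comp hf.isInducing
  obtain ⟨V, hVopen, hVU, hVcover, hVpc⟩ :=
    exists_pointCountable_refinement hIic F hF U hU hxU
  refine isSigmaDiscrete_of_pointCountable_cover V hVopen (fun i => ?_) hVcover hVpc
  obtain ⟨z, hz⟩ := hVU i
  exact (hUc z).mono hz
end
end

section
/- If K is a compact Hausdorff space and X = {x_α : α < ω₁} ⊆ C_p(K) is a right-separated transfinite sequence of length ω₁, then X is σ-discrete. -/
open Set Topology Ordinal Cardinal

noncomputable section
universe u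

/-- A family of points that is locally countable for a symmetric relation admits a colouring
by natural numbers in which distinct related points get distinct colours. -/
theorem exists_natColoring_of_countable_neighbors {ι : Type*} (S : ι → ι → Prop)
    (hsymm : ∀ a b, S a b → S b a) (hS : ∀ a, {b | S a b}.Countable) :
    ∃ c : ι → ℕ, ∀ a b, S a b → a ≠ b → c a ≠ c b := by
  classical
  let N : ι → ℕ → Set ι := fun a n => Nat.rec {a} (fun _ s => ⋃ b ∈ s, {d | S b d}) n
  have hN : ∀ a n, (N a n).Countable := by
    intro a n
    induction n with
    | zero => exact countable_singleton a
    | succ n ih => exact ih.biUnion fun b _ => hS b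
  have hcomp : ∀ a, {b | Relation.ReflTransGen S a b}.Countable := by
    intro a
    refine (countable_iUnion (hN a)).mono fun b hb => ?_
    induction (show Relation.ReflTransGen S a b from hb) with
    | refl => exact mem_iUnion.2 ⟨0, rfl⟩
    | tail h1 h2 ih =>
      obtain ⟨n, hn⟩ := mem_iUnion.1 (ih h1)
      exact mem_iUnion.2 ⟨n + 1, mem_biUnion hn h2⟩
  have : Std.Symm S := ⟨hsymm⟩
  let T : Setoid ι :=
    { r := Relation.ReflTransGen S
      iseqv := ⟨fun _ => .refl, fun h => (Relation.ReflTransGen.stdSymm (r := S)).symm _ _ h,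
        fun h h' => h.trans h'⟩ }
  have hinj : ∀ q : Quotient T, ∃ e : ι → ℕ, InjOn e {b | Relation.ReflTransGen S q.out b} :=
    fun q => countable_iff_exists_injOn.1 (hcomp q.out)
  choose e he using hinj
  refine ⟨fun a => e (Quotient.mk T a) a, fun a b hab hne heq => hne ?_⟩
  have hq : Quotient.mk T a = Quotient.mk T b := Quotient.sound (.single hab)
  have hb : Relation.ReflTransGen S (Quotient.mk T b).out b := Quotient.mk_out (s := T) b
  have ha : Relation.ReflTransGen S (Quotient.mk T b).out a :=
    hb.trans (.single (hsymm _ _ hab))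
  exact he (Quotient.mk T b) ha hb (by simpa only [hq] using heq)

/-- `h` is controlled up to `δ` by finitely many scaled members of the family `g`. -/
def ControlledBy {ι L : Type*} (g : ι → L → ℝ) (δ : ℝ) (F : Finset (ι × ℕ)) (h : L → ℝ) : Prop :=
  ∀ s t, (∀ p ∈ F, |(p.2 : ℝ) * g p.1 s - p.2 * g p.1 t| ≤ 1) → |h s - h t| < δ

/-- A continuous function in the pointwise closure of a family of continuous functions on a
compact space is controlled by finitely many of its members. -/
theorem exists_controlledBy_of_mem_closure {ι L : Type*} [TopologicalSpace L] [CompactSpace L]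
    {g : ι → L → ℝ} (hg : ∀ a, Continuous (g a)) {h : L → ℝ} (hh : Continuous h)
    {Γ : Set ι} (hcl : h ∈ closure (g '' Γ)) {δ : ℝ} (hδ : 0 < δ) :
    ∃ F : Finset (ι × ℕ), (∀ p ∈ F, p.1 ∈ Γ) ∧ ControlledBy g δ F h := by
  classical
  have hfib : ∀ s t, (∀ a ∈ Γ, g a s = g a t) → h s = h t := by
    intro s t hst
    have hc : IsClosed {k : L → ℝ | k s = k t} :=
      isClosed_eq (continuous_apply s) (continuous_apply t)
    refine closure_minimal ?_ hc hcl
    rintro _ ⟨a, ha, rfl⟩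
    exact hst a ha
  have hZ : IsCompact {p : L × L | δ ≤ |h p.1 - h p.2|} :=
    (isClosed_le continuous_const (by fun_prop)).isCompact
  obtain ⟨F, hF⟩ := hZ.elim_finite_subcover
    (fun q : Γ × ℕ => {p : L × L | 1 < |(q.2 : ℝ) * g q.1 p.1 - q.2 * g q.1 p.2|})
    (fun q => isOpen_lt continuous_const (by have := hg q.1; fun_prop))
    (by
      intro p hp
      have hne : ∃ a ∈ Γ, g a p.1 ≠ g a p.2 := by
        by_contra! hcon
        have hp' : δ ≤ |h p.1 - h p.2| := hp
        rw [hfib _ _ hcon, _root_.sub_self, abs_zero] at hp'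
        exact absurd hp' (not_le.2 hδ)
      obtain ⟨a, ha, hne⟩ := hne
      have hpos : 0 < |g a p.1 - g a p.2| := abs_pos.2 (sub_ne_zero.2 hne)
      obtain ⟨n, hn⟩ := exists_nat_gt (1 / |g a p.1 - g a p.2|)
      refine mem_iUnion.2 ⟨(⟨a, ha⟩, n), ?_⟩
      rw [div_lt_iff₀ hpos] at hn
      change 1 < |(n : ℝ) * g a p.1 - n * g a p.2|
      rwa [← _root_.mul_sub, abs_mul, Nat.abs_cast])
  refine ⟨F.image fun q => ((q.1 : ι), q.2), ?_, ?_⟩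
  · intro p hp
    obtain ⟨q, -, rfl⟩ := Finset.mem_image.1 hp
    exact q.1.2
  · intro s t hst
    by_contra! hcon
    obtain ⟨q, hq, hlt⟩ := mem_iUnion₂.1 (hF (show (s, t) ∈ {p : L × L | _} from hcon))
    exact absurd (hst _ (Finset.mem_image_of_mem _ hq)) (not_le.2 hlt)

/-- Among functions that are pairwise at uniform distance at least `ε`, only countably many are
controlled up to `ε / 4` by a given finite family. -/
theorem countable_setOf_controlledBy {ι L : Type*} [TopologicalSpace L] [CompactSpace L]
    {g : ι → L → ℝ} (hg : ∀ a, Continuous (g a)) {ε : ℝ} (hε : 0 < ε)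
    (hsep : ∀ a b, a ≠ b → ∃ t, ε ≤ |g a t - g b t|) (F : Finset (ι × ℕ)) :
    {b | ControlledBy g (ε / 4) F (g b)}.Countable := by
  classical
  let G : L → (F → ℝ) := fun s p => (p.1.2 : ℝ) * g p.1.1 s
  have hG : Continuous G := continuous_pi fun p => continuous_const.mul (hg _)
  obtain ⟨T, hTsub, hTfin, hT⟩ := (isCompact_range hG).finite_cover_balls one_pos
  choose r hr using hTsub
  have : Finite T := hTfin
  let φ : ι → (T → ℤ) := fun b y => ⌊g b (r y.2) / (ε / 4)⌋
  refine MapsTo.countable_of_injOn (f := φ) (t := univ) (fun _ _ => mem_univ _) ?_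
    (to_countable _)
  intro a ha b hb hab
  by_contra hne
  obtain ⟨t, ht⟩ := hsep a b hne
  obtain ⟨y, hy, hty⟩ := mem_iUnion₂.1 (hT (mem_range_self t))
  have hclose : ∀ p ∈ F, |(p.2 : ℝ) * g p.1 t - p.2 * g p.1 (r hy)| ≤ 1 := by
    intro p hp
    have h1 := (dist_le_pi_dist (G t) y ⟨p, hp⟩).trans (Metric.mem_ball.1 hty).le
    rw [← hr hy] at h1
    exact h1
  have h1 := ha t (r hy) hclose
  have h2 := hb t (r hy) hclose
  have h3 := Int.abs_sub_lt_one_of_floor_eq_floor (congrFun hab ⟨y, hy⟩)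
  rw [← sub_div, abs_div, abs_of_pos (by positivity : 0 < ε / 4),
    div_lt_one (by positivity)] at h3
  rw [abs_lt] at h1 h2 h3
  have h4 : |g a t - g b t| < ε := abs_lt.2 ⟨by linarith, by linarith⟩
  linarith

/-- A family of continuous functions on a compact space, indexed by a linear order with countable
initial segments and right-separated by single points with a uniform gap, is a countable union of
relatively discrete subfamilies. -/
theorem exists_natColoring_notMem_closure {ι L : Type*} [LinearOrder ι]
    (hι : ∀ a : ι, (Iic a).Countable) [TopologicalSpace L] [CompactSpace L]
    {g : ι → L → ℝ} (hg : ∀ a, Continuous (g a)) (t : ι → L) {ε : ℝ} (hε : 0 < ε)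
    (h₁ : ∀ a, g a (t a) ≤ ε) (h₂ : ∀ a b, a < b → 2 * ε ≤ g b (t a)) :
    ∃ c : ι → ℕ, ∀ b, g b ∉ closure (g '' {a | a ≠ b ∧ c a = c b}) := by
  classical
  have hsep : ∀ a b, a ≠ b → ∃ t, ε ≤ |g a t - g b t| := by
    intro a b hne
    rcases lt_or_gt_of_ne hne with hab | hab
    · refine ⟨t a, le_abs.2 (Or.inr ?_)⟩
      linarith [h₁ a, h₂ a b hab]
    · refine ⟨t b, le_abs.2 (Or.inl ?_)⟩
      linarith [h₁ b, h₂ b a hab]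
  let R : ι → ι → Prop := fun a b =>
    a < b ∧ ∃ F : Finset (ι × ℕ), (∀ p ∈ F, p.1 ≤ a) ∧ ControlledBy g (ε / 4) F (g b)
  have hup : ∀ a, {b | R a b}.Countable := by
    intro a
    have hc : {F : Finset (ι × ℕ) | ∀ p ∈ F, p.1 ≤ a}.Countable := by
      have h := countable_ofPred_finite_subset ((hι a).prod (countable_univ (α := ℕ)))
      refine (h.preimage Finset.coe_injective).mono fun F hF => ?_
      exact ⟨F.finite_toSet, fun p hp => ⟨hF p hp, mem_univ _⟩⟩
    refine (hc.biUnion fun F _ => countable_setOf_controlledBy hg hε hsep F).mono ?_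
    rintro b ⟨-, F, hF, hb⟩
    exact mem_biUnion hF hb
  obtain ⟨c, hc⟩ := exists_natColoring_of_countable_neighbors (fun a b => R a b ∨ R b a)
    (fun a b => Or.symm)
    (fun a => (hup a).union ((hι a).mono fun b hb => le_of_lt hb.1))
  refine ⟨c, fun b hb => ?_⟩
  have hsub : g '' {a | a ≠ b ∧ c a = c b} ⊆
      g '' {a | a < b ∧ ¬ R a b} ∪ g '' {a | b < a} := by
    rintro _ ⟨a, ⟨hne, hca⟩, rfl⟩
    rcases lt_or_gt_of_ne hne with hab | hab
    · exact Or.inl ⟨a, ⟨hab, fun hR => hc a b (Or.inl hR) hne hca⟩, rfl⟩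
    · exact Or.inr ⟨a, hab, rfl⟩
  have hb' := closure_mono hsub hb
  rw [closure_union] at hb'
  rcases hb' with hlow | hhigh
  · obtain ⟨F, hFΓ, hF⟩ :=
      exists_controlledBy_of_mem_closure hg (hg b) hlow (by positivity : 0 < ε / 4)
    rcases F.eq_empty_or_nonempty with rfl | hne
    · obtain ⟨_, a, ha, -⟩ := closure_nonempty_iff.1 ⟨_, hlow⟩
      exact ha.2 ⟨ha.1, ∅, by simp, hF⟩
    · obtain ⟨p, hp, hmax⟩ := F.exists_max_image Prod.fst hne
      exact (hFΓ p hp).2 ⟨(hFΓ p hp).1, F, hmax, hF⟩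
  · have hcl : IsClosed {k : L → ℝ | 2 * ε ≤ k (t b)} :=
      isClosed_le continuous_const (continuous_apply _)
    have : 2 * ε ≤ g b (t b) := by
      refine closure_minimal ?_ hcl hhigh
      rintro _ ⟨a, ha, rfl⟩
      exact h₂ b a ha
    linarith [h₁ b]

/-- A neighbourhood of a function in the topology of pointwise convergence contains a basic one
described by a finite tuple of points, a tuple of rational values and a natural number. -/
theorem exists_rational_separation {K : Type*} {O : Set (K → ℝ)} (hO : IsOpen O) {h : K → ℝ}
    (hh : h ∈ O) :
    ∃ (n m : ℕ) (q : Fin n → ℚ) (x : Fin n → K),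
      dist (fun i => h (x i)) (fun i => (q i : ℝ)) ≤ 1 / ((m : ℝ) + 1) ∧
      ∀ k ∉ O, 2 * (1 / ((m : ℝ) + 1)) ≤ dist (fun i => k (x i)) (fun i => (q i : ℝ)) := by
  obtain ⟨I, u, hu, hIu⟩ := isOpen_pi_iff.1 hO h hh
  have hev : ∀ᶠ m : ℕ in Filter.atTop, ∀ a ∈ I,
      Metric.ball (h a) (3 * (1 / ((m : ℝ) + 1))) ⊆ u a := by
    rw [Filter.eventually_all_finset]
    intro a ha
    obtain ⟨δ, hδ, hball⟩ := Metric.isOpen_iff.1 (hu a ha).1 _ (hu a ha).2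
    have hlim : Filter.Tendsto (fun m : ℕ => 3 * (1 / ((m : ℝ) + 1))) Filter.atTop (𝓝 (3 * 0)) :=
      tendsto_one_div_add_atTop_nhds_zero_nat.const_mul 3
    rw [mul_zero] at hlim
    filter_upwards [hlim.eventually (gt_mem_nhds hδ)] with m hm
    exact (Metric.ball_subset_ball hm.le).trans hball
  obtain ⟨m, hm⟩ := hev.exists
  have hpos : (0 : ℝ) < 1 / ((m : ℝ) + 1) := by positivity
  have hq : ∀ y : ℝ, ∃ q : ℚ, dist y q < 1 / ((m : ℝ) + 1) := fun y => by
    obtain ⟨q, hq⟩ := exists_rat_near y hpos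
    exact ⟨q, hq⟩
  choose q hq using hq
  let x : Fin I.card → K := fun i => I.equivFin.symm i
  refine ⟨I.card, m, fun i => q (h (x i)), x, ?_, ?_⟩
  · exact (dist_pi_le_iff hpos.le).2 fun i => (hq _).le
  · intro k hk
    by_contra! hlt
    refine hk (hIu fun a ha => hm a ha ?_)
    have h1 := (dist_le_pi_dist _ _ (I.equivFin ⟨a, ha⟩)).trans_lt hlt
    have h2 := hq (h a)
    simp only [x, Equiv.symm_apply_apply] at h1
    rw [Metric.mem_ball]
    have h3 := dist_triangle_right (k a) (h a) (q (h a) : ℝ)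
    linarith

/-- A right-separated family in `C_p(K)`, indexed by a linear order with countable initial
segments, is a countable union of relatively discrete subfamilies. -/
theorem exists_natColoring_of_rightSeparated {ι K : Type*} [LinearOrder ι]
    (hι : ∀ a : ι, (Iic a).Countable) [TopologicalSpace K] [CompactSpace K]
    {f : ι → K → ℝ} (hf : ∀ a, Continuous (f a))
    (hrs : ∀ a, ∃ O : Set (K → ℝ), IsOpen O ∧ f a ∈ O ∧ ∀ b, a < b → f b ∉ O) :
    ∃ c : ι → ℕ, ∀ b, f b ∉ closure (f '' {a | a ≠ b ∧ c a = c b}) := by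
  classical
  have hsep : ∀ a, ∃ (e : Σ n : ℕ, ℕ × (Fin n → ℚ)) (x : Fin e.1 → K),
      dist (fun i => f a (x i)) (fun i => (e.2.2 i : ℝ)) ≤ 1 / ((e.2.1 : ℝ) + 1) ∧
      ∀ b, a < b →
        2 * (1 / ((e.2.1 : ℝ) + 1)) ≤ dist (fun i => f b (x i)) (fun i => (e.2.2 i : ℝ)) := by
    intro a
    obtain ⟨O, hO, ha, hb⟩ := hrs a
    obtain ⟨n, m, q, x, h1, h2⟩ := exists_rational_separation hO ha
    exact ⟨⟨n, m, q⟩, x, h1, fun b hab => h2 _ (hb b hab)⟩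
  choose e x h₁ h₂ using hsep
  have hpiece : ∀ d : Σ n : ℕ, ℕ × (Fin n → ℚ), ∃ c : ι → ℕ, ∀ b, e b = d →
      f b ∉ closure (f '' {a | a ≠ b ∧ e a = d ∧ c a = c b}) := by
    intro d
    let Φ : (K → ℝ) → (Fin d.1 → K) → ℝ := fun k y =>
      dist (fun i => k (y i)) (fun i => (d.2.2 i : ℝ))
    have hΦ : Continuous Φ := by
      refine continuous_pi fun y => ?_
      exact (continuous_pi fun i => continuous_apply (y i)).dist continuous_const
    have hx : ∀ a : {a // e a = d}, ∃ y : Fin d.1 → K,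
        Φ (f a) y ≤ 1 / ((d.2.1 : ℝ) + 1) ∧
        ∀ b, a.1 < b → 2 * (1 / ((d.2.1 : ℝ) + 1)) ≤ Φ (f b) y := by
      rintro ⟨a, rfl⟩
      exact ⟨x a, h₁ a, h₂ a⟩
    choose t ht₁ ht₂ using hx
    obtain ⟨c, hc⟩ := exists_natColoring_notMem_closure (ι := {a // e a = d})
      (fun a => (hι a.1).preimage Subtype.val_injective)
      (g := fun a => Φ (f a))
      (fun a => (continuous_pi fun i => (hf a).comp (continuous_apply i)).dist continuous_const)
      t (by positivity) ht₁ (fun a b hab => ht₂ a b hab)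
    refine ⟨fun a => if h : e a = d then c ⟨a, h⟩ else 0, fun b hb hmem => hc ⟨b, hb⟩ ?_⟩
    refine closure_mono ?_ (image_closure_subset_closure_image hΦ (mem_image_of_mem Φ hmem))
    rintro _ ⟨_, ⟨a, ⟨hne, ha, hca⟩, rfl⟩, rfl⟩
    refine ⟨⟨a, ha⟩, ⟨fun h => hne (congrArg Subtype.val h), ?_⟩, rfl⟩
    simpa [ha, hb] using hca
  choose c hc using hpiece
  obtain ⟨enc, henc⟩ := exists_injective_nat ((Σ n : ℕ, ℕ × (Fin n → ℚ)) × ℕ)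
  refine ⟨fun a => enc (e a, c (e a) a), fun b hb => hc (e b) b rfl (closure_mono ?_ hb)⟩
  rintro _ ⟨a, ⟨hne, ha⟩, rfl⟩
  obtain ⟨h1, h2⟩ := Prod.mk.inj (henc ha)
  exact ⟨a, ⟨hne, h1, by rw [← h2, h1]⟩, rfl⟩

/-- Initial segments of `ω₁` are countable. -/
theorem countable_Iic_subtype_lt_omega_one (a : {a : Ordinal // a < ω₁}) : (Iic a).Countable := by
  have hlt := lt_omega_iff_card_lt.1 ((isSuccLimit_omega 1).succ_lt a.2)
  have h : (Iio (Order.succ a.1)).Countable := by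
    rw [← le_aleph0_iff_set_countable, Cardinal.mk_Iio_ordinal, lift_le_aleph0,
      ← Order.lt_succ_iff, succ_aleph0]
    exact hlt
  refine (h.preimage Subtype.val_injective).mono fun b hb => ?_
  exact Order.lt_succ_iff.2 (show b.1 ≤ a.1 from hb)

/-- If `K` is a compact Hausdorff space and `X = {x_α : α < ω₁} ⊆ C_p(K)` is a
right-separated transfinite sequence of length `ω₁` (each initial segment is open in the
subspace `X`), then `X` is σ-discrete. -/
theorem sigmaDiscrete_of_rightSeparated_omega1_in_Cp
    (K : Type u) [TopologicalSpace K] [CompactSpace K] [T2Space K]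
    (f : {a : Ordinal // a < ω₁} → {g : K → ℝ // Continuous g})
    (hinj : Function.Injective f)
    (hrs : ∀ μ : Ordinal, μ < ω₁ →
      ∃ O : Set {g : K → ℝ // Continuous g}, IsOpen O ∧
        O ∩ Set.range f = f '' {a : {a : Ordinal // a < ω₁} | (a : Ordinal) < μ}) :
    IsSigmaDiscrete (Set.range f) := by
  obtain ⟨c, hc⟩ := exists_natColoring_of_rightSeparated
    countable_Iic_subtype_lt_omega_one (f := fun a => (f a).1) (fun a => (f a).2) (by
      intro a
      obtain ⟨O, hO, hOf⟩ := hrs (Order.succ a.1) ((isSuccLimit_omega 1).succ_lt a.2)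
      obtain ⟨V, hV, rfl⟩ := isOpen_induced_iff.1 hO
      refine ⟨V, hV, ?_, fun b hab hb => ?_⟩
      · have : f a ∈ Subtype.val ⁻¹' V ∩ range f :=
          hOf ▸ mem_image_of_mem f (Order.lt_succ a.1)
        exact this.1
      · have : f b ∈ Subtype.val ⁻¹' V ∩ range f := ⟨hb, mem_range_self b⟩
        rw [hOf, hinj.mem_set_image] at this
        exact absurd (Order.lt_succ_iff.1 (show b.1 < Order.succ a.1 from this)) (not_le.2 hab))
  refine ⟨fun n => {y | ∃ a, c a = n ∧ (y : {g : K → ℝ // Continuous g}) = f a}, ?_, fun n => ?_⟩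
  · rw [eq_univ_iff_forall]
    rintro ⟨_, a, rfl⟩
    exact mem_iUnion.2 ⟨c a, a, rfl, rfl⟩
  · rw [discreteTopology_subtype_iff']
    rintro ⟨_, _⟩ ⟨b, rfl, rfl⟩
    refine ⟨(fun y : range f => y.1.1) ⁻¹'
      (closure ((fun a => (f a).1) '' {a | a ≠ b ∧ c a = c b}))ᶜ,
      isClosed_closure.isOpen_compl.preimage
        (continuous_subtype_val.comp continuous_subtype_val), ?_⟩
    ext ⟨y, hy⟩
    constructor
    · rintro ⟨hmem, a, hca, rfl⟩
      by_contra hne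
      refine hmem (subset_closure ⟨a, ⟨?_, hca⟩, rfl⟩)
      rintro rfl
      exact hne rfl
    · rintro h
      obtain rfl : y = f b := congrArg Subtype.val h
      exact ⟨hc b, b, rfl, rfl⟩
end
end

section
/- Every Eberlein–Grothendieck space X that can be enumerated as a right-separated transfinite sequence X = {x_α : α < λ} with λ < ω₁·ω₁ is σ-discrete. -/
open Set Topology Ordinal Cardinal

noncomputable section
universe u

/-- The function `g` varies by less than `ε` between any two points that the finitely many
functions `x p.1`, `p ∈ D`, separate by at most `1 / (p.2 + 1)`. -/
def IsControlledBy {K S : Type*} (x : S → K → ℝ) (ε : ℝ) (D : Finset (S × ℕ)) (g : K → ℝ) :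
    Prop :=
  ∀ s t, ε ≤ |g s - g t| → ∃ p ∈ D, 1 / ((p.2 : ℝ) + 1) < |x p.1 s - x p.1 t|

/-- A uniformly separated family of functions controlled by the same finite data is countable. -/
theorem countable_isControlledBy {K S : Type*} [TopologicalSpace K] [CompactSpace K]
    {x : S → K → ℝ} (hx : ∀ a, Continuous (x a)) {ε : ℝ} (hε : 0 < ε)
    (hsep : ∀ a b, a ≠ b → ∃ t, 3 * ε ≤ |x a t - x b t|) (D : Finset (S × ℕ)) :
    {a | IsControlledBy x ε D (x a)}.Countable := by
  classical
  let W : K → Set K := fun s => {t | ∀ p ∈ D, |x p.1 s - x p.1 t| < 1 / ((p.2 : ℝ) + 1)}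
  have hW : ∀ s, W s ∈ 𝓝 s := by
    intro s
    have : ∀ p ∈ D, ∀ᶠ t in 𝓝 s, |x p.1 s - x p.1 t| < 1 / ((p.2 : ℝ) + 1) := by
      intro p _
      have hc : Continuous fun t => |x p.1 s - x p.1 t| :=
        (continuous_const.sub (hx p.1)).abs
      refine hc.continuousAt.eventually_lt continuousAt_const ?_
      rw [_root_.sub_self, abs_zero]
      positivity
    exact (Filter.eventually_all_finset D).2 this
  obtain ⟨T, hT⟩ := CompactSpace.elim_nhds_subcover W hW
  let r : S → T → ℝ := fun a t => x a t
  refine Set.PairwiseDisjoint.countable_of_isOpen (s := fun a => Metric.ball (r a) (ε / 2))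
    ?_ (fun _ _ => Metric.isOpen_ball) (fun _ _ => ⟨_, Metric.mem_ball_self (by linarith)⟩)
  intro a ha b hb hab
  refine Metric.ball_disjoint_ball ?_
  by_contra! hlt
  obtain ⟨s, hs⟩ := hsep a b hab
  have hsT : s ∈ ⋃ t ∈ T, W t := hT ▸ Set.mem_univ s
  simp only [Set.mem_iUnion] at hsT
  obtain ⟨t, htT, hst⟩ := hsT
  have key : ∀ c, IsControlledBy x ε D (x c) → |x c t - x c s| < ε := by
    intro c hc
    by_contra! h
    obtain ⟨p, hp, hlt⟩ := hc t s h
    exact absurd (hst p hp) (not_lt.2 hlt.le)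
  have h1 := abs_lt.1 (key a ha)
  have h2 := abs_lt.1 (key b hb)
  have h3 : |x a t - x b t| < ε / 2 + ε / 2 := by
    have := (dist_le_pi_dist (r a) (r b) ⟨t, htT⟩).trans_lt hlt
    rwa [Real.dist_eq] at this
  rw [abs_lt] at h3
  have h4 : |x a s - x b s| < 3 * ε := abs_lt.2 ⟨by linarith, by linarith⟩
  linarith

/-- A continuous function that factors through the functions `x b`, `b ∈ L`, is controlled by
finitely many of them. -/
theorem exists_isControlledBy {K S : Type*} [TopologicalSpace K] [CompactSpace K]
    {x : S → K → ℝ} (hx : ∀ a, Continuous (x a)) {ε : ℝ} (hε : 0 < ε) {L : Set S}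
    {g : K → ℝ} (hg : Continuous g) (h : ∀ s t, (∀ b ∈ L, x b s = x b t) → g s = g t) :
    ∃ D : Finset (S × ℕ), (∀ p ∈ D, p.1 ∈ L) ∧ IsControlledBy x ε D g := by
  classical
  let Z : Set (K × K) := {q | ε ≤ |g q.1 - g q.2|}
  have hZ : IsCompact Z := by
    refine IsClosed.isCompact (isClosed_le continuous_const ?_)
    exact ((hg.comp continuous_fst).sub (hg.comp continuous_snd)).abs
  let U : L × ℕ → Set (K × K) := fun p => {q | 1 / ((p.2 : ℝ) + 1) < |x p.1 q.1 - x p.1 q.2|}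
  obtain ⟨E, hE⟩ := hZ.elim_finite_subcover U
    (fun p => isOpen_lt continuous_const
      (((hx p.1).comp continuous_fst).sub ((hx p.1).comp continuous_snd)).abs) (by
    rintro ⟨s, t⟩ hst
    have hst : ε ≤ |g s - g t| := hst
    have hne : g s ≠ g t := by
      intro he
      rw [sub_eq_zero.2 he, abs_zero] at hst
      linarith
    have : ∃ b ∈ L, x b s ≠ x b t := by
      by_contra! hb
      exact hne (h s t hb)
    obtain ⟨b, hb, hbst⟩ := this
    obtain ⟨m, hm⟩ := exists_nat_one_div_lt (abs_pos.2 (sub_ne_zero.2 hbst))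
    exact Set.mem_iUnion.2 ⟨(⟨b, hb⟩, m), hm⟩)
  refine ⟨E.image fun p => ((p.1 : S), p.2), ?_, ?_⟩
  · intro p hp
    obtain ⟨q, _, rfl⟩ := Finset.mem_image.1 hp
    exact q.1.2
  · intro s t hst
    have := hE (show (s, t) ∈ Z from hst)
    simp only [Set.mem_iUnion] at this
    obtain ⟨p, hp, hpst⟩ := this
    exact ⟨_, Finset.mem_image_of_mem _ hp, hpst⟩

/-- In a linear order with countable initial segments, if every finite set of data `D` produces
only countably many elements `N D`, then every element lies in a countable lower set closed
under the operation `N`. -/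
theorem exists_countable_closed_isLowerSet {S : Type*} [LinearOrder S]
    (hS : ∀ a : S, (Set.Iio a).Countable) (N : Finset (S × ℕ) → Set S)
    (hN : ∀ D, (N D).Countable) (a : S) :
    ∃ J : Set S, J.Countable ∧ IsLowerSet J ∧ a ∈ J ∧
      ∀ D : Finset (S × ℕ), (∀ p ∈ D, p.1 ∈ J) → N D ⊆ J := by
  classical
  have hIic : ∀ a : S, (Set.Iic a).Countable := fun a => by
    rw [← Set.Iio_insert]
    exact (hS a).insert a
  let step : Set S → Set S := fun J =>
    J ∪ ⋃ D ∈ {D : Finset (S × ℕ) | ∀ p ∈ D, p.1 ∈ J}, ⋃ b ∈ N D, Set.Iic b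
  have hstep : ∀ J : Set S, J.Countable → (step J).Countable := by
    intro J hJ
    refine hJ.union (Set.Countable.biUnion ?_ fun D _ => (hN D).biUnion fun b _ => hIic b)
    have hc : (J ×ˢ (Set.univ : Set ℕ)).Countable := hJ.prod Set.countable_univ
    refine (Set.countable_ofPred_finite_subset hc).preimage_of_injOn
      (f := fun D : Finset (S × ℕ) => (D : Set (S × ℕ))) Finset.coe_injective.injOn |>.mono ?_
    intro D hD
    exact ⟨D.finite_toSet, fun p hp => ⟨hD p hp, trivial⟩⟩
  let J : ℕ → Set S := fun n => step^[n] (Set.Iic a)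
  have hJs : ∀ n, J (n + 1) = step (J n) := fun n => Function.iterate_succ_apply' _ _ _
  have hmono : Monotone J := monotone_nat_of_le_succ fun n => by
    rw [hJs]
    exact Set.subset_union_left
  refine ⟨⋃ n, J n, ?_, ?_, Set.mem_iUnion.2 ⟨0, le_refl a⟩, ?_⟩
  · refine Set.countable_iUnion fun n => ?_
    induction n with
    | zero => exact hIic a
    | succ n ih =>
      rw [hJs]
      exact hstep _ ih
  · refine isLowerSet_iUnion fun n => ?_
    induction n with
    | zero => exact isLowerSet_Iic a
    | succ n ih =>
      rw [hJs]
      exact ih.union (isLowerSet_iUnion₂ fun D _ => isLowerSet_iUnion₂ fun b _ =>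
        isLowerSet_Iic b)
  · intro D hD b hb
    have : ∃ n, ∀ p ∈ D, p.1 ∈ J n := by
      have h : ∀ p ∈ D, ∀ᶠ n in Filter.atTop, p.1 ∈ J n := by
        intro p hp
        obtain ⟨n, hn⟩ := Set.mem_iUnion.1 (hD p hp)
        exact Filter.eventually_atTop.2 ⟨n, fun m hm => hmono hm hn⟩
      exact ((Filter.eventually_all_finset D).2 h).exists
    obtain ⟨n, hn⟩ := this
    refine Set.mem_iUnion.2 ⟨n + 1, ?_⟩
    rw [hJs]
    exact Or.inr (Set.mem_biUnion hn (Set.mem_biUnion hb (le_refl b)))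

/-- A family of continuous functions on a compact space, indexed by a linear order with countable
initial segments and uniformly right-separated, admits a countable colouring whose colour classes
are discrete for pointwise convergence. -/
theorem exists_discrete_colouring {K S : Type*} [TopologicalSpace K] [CompactSpace K]
    [LinearOrder S] (hS : ∀ a : S, (Set.Iio a).Countable)
    {x : S → K → ℝ} (hx : ∀ a, Continuous (x a)) {ε : ℝ} (hε : 0 < ε)
    (hsep : ∀ a, ∃ F : Finset K, ∀ b, a < b → ∃ t ∈ F, ε ≤ |x a t - x b t|) :
    ∃ e : S → ℕ, ∀ a, ∃ U : Set (K → ℝ), IsOpen U ∧ x a ∈ U ∧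
      ∀ b, e b = e a → x b ∈ U → b = a := by
  classical
  let N : Finset (S × ℕ) → Set S := fun D => {a | IsControlledBy x (ε / 3) D (x a)}
  have hε3 : 0 < ε / 3 := by positivity
  have hN : ∀ D, (N D).Countable := by
    refine countable_isControlledBy hx hε3 fun a b hab => ?_
    rw [mul_div_cancel₀ ε three_ne_zero]
    rcases lt_or_gt_of_ne hab with h | h
    · obtain ⟨F, hF⟩ := hsep a
      obtain ⟨t, _, ht⟩ := hF b h
      exact ⟨t, ht⟩
    · obtain ⟨F, hF⟩ := hsep b
      obtain ⟨t, _, ht⟩ := hF a h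
      exact ⟨t, by rwa [abs_sub_comm]⟩
  let Cl : Set S → Prop := fun J => IsLowerSet J ∧
    ∀ D : Finset (S × ℕ), (∀ p ∈ D, p.1 ∈ J) → N D ⊆ J
  let L : S → Set S := fun a => ⋃₀ {J | Cl J ∧ a ∉ J}
  have haL : ∀ a, a ∉ L a := by
    rintro a ⟨J, ⟨_, h⟩, haJ⟩
    exact h haJ
  have hLlow : ∀ a, IsLowerSet (L a) := fun a => isLowerSet_sUnion fun J hJ => hJ.1.1
  have hLcl : ∀ a (D : Finset (S × ℕ)), (L a).Nonempty → (∀ p ∈ D, p.1 ∈ L a) → a ∉ N D := by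
    rintro a D ⟨c, J, ⟨hJ, haJ⟩, _⟩ hD ha
    rcases D.eq_empty_or_nonempty with rfl | hne
    · exact haJ (hJ.2 ∅ (by simp) ha)
    · obtain ⟨p, hp, hmax⟩ := D.exists_max_image Prod.fst hne
      obtain ⟨J, ⟨hJ, haJ⟩, hpJ⟩ := hD p hp
      exact haJ (hJ.2 D (fun q hq => hJ.1 (hmax q hq) hpJ) ha)
  have hblock : ∀ a, {b | L b = L a}.Countable := by
    intro a
    obtain ⟨J, hJc, hJl, haJ, hJ⟩ := exists_countable_closed_isLowerSet hS N hN a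
    refine hJc.mono fun b hb => ?_
    by_contra hbJ
    have : a ∈ L b := ⟨J, ⟨⟨hJl, hJ⟩, hbJ⟩, haJ⟩
    rw [hb] at this
    exact haL a this
  have henc : ∀ M : Set S, ∃ e : S → ℕ, Set.InjOn e {b | L b = M} := by
    intro M
    have : {b | L b = M}.Countable := by
      rcases Set.eq_empty_or_nonempty {b | L b = M} with h | ⟨a, rfl⟩
      · rw [h]
        exact Set.countable_empty
      · exact hblock a
    exact Set.countable_iff_exists_injOn.1 this
  choose enc henc using henc
  refine ⟨fun a => enc (L a) a, fun a => ?_⟩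
  have hV : ∃ V : Set (K → ℝ), IsOpen V ∧ x a ∈ V ∧ ∀ b ∈ L a, x b ∉ V := by
    rcases (L a).eq_empty_or_nonempty with hL | hL
    · exact ⟨Set.univ, isOpen_univ, trivial, by simp [hL]⟩
    have hpair : ∃ s t, (∀ b ∈ L a, x b s = x b t) ∧ x a s ≠ x a t := by
      by_contra! h
      obtain ⟨D, hD, hc⟩ := exists_isControlledBy hx hε3 (hx a) h
      exact hLcl a D hL hD hc
    obtain ⟨s, t, hst, hast⟩ := hpair
    exact ⟨{g | g s ≠ g t}, isOpen_ne_fun (continuous_apply s) (continuous_apply t), hast,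
      fun b hb hne => hne (hst b hb)⟩
  obtain ⟨V, hVo, haV, hV⟩ := hV
  obtain ⟨F, hF⟩ := hsep a
  refine ⟨V ∩ ⋂ i ∈ F, {g | |x a i - g i| < ε}, ?_, ⟨haV, ?_⟩, ?_⟩
  · refine hVo.inter (isOpen_biInter_finset fun i _ => ?_)
    exact isOpen_lt (continuous_const.sub (continuous_apply i)).abs continuous_const
  · simp [hε]
  · rintro b hb ⟨hbV, hbF⟩
    simp only [Set.mem_iInter] at hbF
    rcases lt_trichotomy b a with h | h | h
    · have hsub : L b ⊆ L a := by
        rintro c ⟨J, ⟨hJ, hbJ⟩, hc⟩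
        exact ⟨J, ⟨hJ, fun ha => hbJ (hJ.1 h.le ha)⟩, hc⟩
      by_cases hbL : b ∈ L a
      · exact absurd hbV (hV b hbL)
      · have heq : L b = L a := by
          refine hsub.antisymm ?_
          rintro c ⟨J, hJ, hc⟩
          exact ⟨J, ⟨hJ.1, fun hbJ => hbL ⟨J, hJ, hbJ⟩⟩, hc⟩
        simp only [heq] at hb
        exact henc (L a) heq rfl hb
    · exact h
    · obtain ⟨i, hi, hle⟩ := hF b h
      exact absurd (hbF i hi) (not_lt.2 hle)

theorem countable_Iio_of_lt_omega_one {o : Ordinal} (ho : o < ω₁) : (Set.Iio o).Countable := by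
  rw [← Set.countable_coe_iff, ← Cardinal.mk_le_aleph0_iff, Cardinal.mk_Iio_ordinal,
    Cardinal.lift_le_aleph0, ← Cardinal.lt_aleph_one_iff, ← Cardinal.lt_ord]
  simpa using ho

/-- A space with a countable colouring all of whose colour classes are discrete is σ-discrete. -/
theorem isSigmaDiscrete_of_colouring {X ι : Type*} [TopologicalSpace X] [Countable ι] (c : X → ι)
    (hc : ∀ x, ∃ U : Set X, IsOpen U ∧ x ∈ U ∧ ∀ y ∈ U, c y = c x → y = x) :
    IsSigmaDiscrete X := by
  obtain ⟨e, he⟩ := exists_injective_nat ι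
  refine ⟨fun n => {x | e (c x) = n}, ?_, fun n => ?_⟩
  · ext x
    simp
  · rw [discreteTopology_subtype_iff']
    rintro x hx
    obtain ⟨U, hU, hxU, h⟩ := hc x
    refine ⟨U, hU, Set.eq_singleton_iff_unique_mem.2 ⟨⟨hxU, hx⟩, ?_⟩⟩
    rintro y ⟨hyU, hy⟩
    exact h y hyU (he (hy.trans hx.symm))

/-- Basic neighbourhoods for pointwise convergence are given by a finite set and a rational
tolerance. -/
theorem exists_finset_nat_of_isOpen_pi {K : Type*} {O : Set (K → ℝ)} (hO : IsOpen O) {g : K → ℝ}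
    (hg : g ∈ O) :
    ∃ (n : ℕ) (F : Finset K), ∀ h, (∀ t ∈ F, |g t - h t| < 1 / ((n : ℝ) + 1)) → h ∈ O := by
  obtain ⟨F, u, hu, hsub⟩ := isOpen_pi_iff.1 hO g hg
  have : ∀ t ∈ F, ∀ᶠ n : ℕ in Filter.atTop, Metric.ball (g t) (1 / ((n : ℝ) + 1)) ⊆ u t := by
    intro t ht
    obtain ⟨δ, hδ, hball⟩ := Metric.isOpen_iff.1 (hu t ht).1 _ (hu t ht).2
    filter_upwards [(tendsto_one_div_add_atTop_nhds_zero_nat (𝕜 := ℝ)).eventually_lt_const hδ]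
      with n hn
    exact (Metric.ball_subset_ball hn.le).trans hball
  obtain ⟨n, hn⟩ := ((Filter.eventually_all_finset F).2 this).exists
  refine ⟨n, F, fun h hh => hsub fun t ht => hn t ht ?_⟩
  rw [Metric.mem_ball, dist_comm, Real.dist_eq]
  exact hh t ht

/-- Every Eberlein–Grothendieck space that can be enumerated as a right-separated
transfinite sequence `X = {x_α : α < λ}` with `λ < ω₁ · ω₁` is σ-discrete. -/
theorem sigmaDiscrete_of_EG_rightSeparated_lt_omega1_mul_omega1
    (X : Type u) [TopologicalSpace X] (hEG : EberleinGrothendieck X)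
    (lam : Ordinal) (hlam : lam < ω₁ * ω₁)
    (f : {a : Ordinal // a < lam} → X) (hbij : Function.Bijective f)
    (hrs : ∀ μ : Ordinal, μ < lam →
      IsOpen (f '' {a : {a : Ordinal // a < lam} | (a : Ordinal) < μ})) :
    IsSigmaDiscrete X := by
  classical
  obtain ⟨K, _, _, _, φ, hφ⟩ := hEG
  let x : {a : Ordinal // a < lam} → K → ℝ := fun a => (φ (f a)).1
  have hx : ∀ a, Continuous (x a) := fun a => (φ (f a)).2
  have hemb : IsEmbedding fun y : X => (φ y).1 := IsEmbedding.subtypeVal.comp hφ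
  have hright : ∀ a, ∃ (n : ℕ) (F : Finset K), ∀ b, a < b →
      ∃ t ∈ F, 1 / ((n : ℝ) + 1) ≤ |x a t - x b t| := by
    intro a
    have hopen : IsOpen (f '' {b | b ≤ a}) := by
      rcases lt_or_ge (Order.succ (a : Ordinal)) lam with h | h
      · simpa only [Order.lt_succ_iff, Subtype.coe_le_coe] using hrs _ h
      · have : {b | b ≤ a} = Set.univ := Set.eq_univ_of_forall fun b =>
          Order.lt_succ_iff.1 (b.2.trans_le h)
        rw [this, Set.image_univ, hbij.2.range_eq]
        exact isOpen_univ
    obtain ⟨O, hO, hOeq⟩ := hemb.isInducing.isOpen_iff.1 hopen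
    have haO : x a ∈ O := by
      have : f a ∈ f '' {b | b ≤ a} := ⟨a, le_refl a, rfl⟩
      rwa [← hOeq] at this
    obtain ⟨n, F, hF⟩ := exists_finset_nat_of_isOpen_pi hO haO
    refine ⟨n, F, fun b hab => ?_⟩
    by_contra! hlt
    have hb : f b ∈ (fun y : X => (φ y).1) ⁻¹' O := hF (x b) hlt
    rw [hOeq] at hb
    obtain ⟨c, hc, hcb⟩ := hb
    rw [hbij.1 hcb] at hc
    exact absurd hab (not_lt.2 hc)
  choose n F hF using hright
  have hω : (ω₁ : Ordinal) ≠ 0 := (Ordinal.omega_pos 1).ne'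
  let q : {a : Ordinal // a < lam} → Set.Iio (Order.succ (lam / ω₁)) := fun a =>
    ⟨a / ω₁, Order.lt_succ_iff.2 (Ordinal.div_le_left a.2.le _)⟩
  have : Countable (Set.Iio (Order.succ (lam / ω₁))) :=
    (countable_Iio_of_lt_omega_one ((Cardinal.isSuccLimit_omega 1).succ_lt
      ((Ordinal.lt_mul_iff_div_lt hω).1 hlam))).to_subtype
  let col : {a : Ordinal // a < lam} → Set.Iio (Order.succ (lam / ω₁)) × ℕ := fun a => (q a, n a)
  have hpiece : ∀ i, ∃ e : {a // col a = i} → ℕ, ∀ a : {a // col a = i}, ∃ U : Set (K → ℝ), IsOpen U ∧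
      x a ∈ U ∧ ∀ b : {a // col a = i}, e b = e a → x b ∈ U → b = a := by
    intro i
    refine exists_discrete_colouring (x := fun a : {a // col a = i} => x a) ?_ (fun a => hx a)
      (ε := 1 / ((i.2 : ℝ) + 1)) (by positivity) ?_
    · intro a
      have hq : ∀ b : {a // col a = i}, (b.1.1 : Ordinal) / ω₁ = i.1 := fun b =>
        congrArg (fun j => (j.1 : Ordinal)) b.2
      refine Set.MapsTo.countable_of_injOn (f := fun b => (b.1.1 : Ordinal) % ω₁)
        (t := Set.Iio ((a.1.1 : Ordinal) % ω₁)) ?_ ?_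
        (countable_Iio_of_lt_omega_one (Ordinal.mod_lt _ hω))
      · intro b hb
        have hb : (b.1.1 : Ordinal) < a.1.1 := hb
        rw [← Ordinal.div_add_mod b.1.1 ω₁, ← Ordinal.div_add_mod a.1.1 ω₁, hq a, hq b] at hb
        exact lt_of_add_lt_add_left hb
      · intro b _ c _ hbc
        have hbc : (b.1.1 : Ordinal) % ω₁ = c.1.1 % ω₁ := hbc
        refine Subtype.ext (Subtype.ext ?_)
        rw [← Ordinal.div_add_mod b.1.1 ω₁, ← Ordinal.div_add_mod c.1.1 ω₁, hq b, hq c, hbc]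
    · rintro ⟨a, rfl⟩
      exact ⟨F a, fun b hab => hF a b hab⟩
  choose e he using hpiece
  let g := (Equiv.ofBijective f hbij).symm
  have hfg : ∀ y, f (g y) = y := (Equiv.ofBijective f hbij).apply_symm_apply
  refine isSigmaDiscrete_of_colouring (fun y => (col (g y), e (col (g y)) ⟨g y, rfl⟩)) fun y => ?_
  obtain ⟨U, hU, hyU, h⟩ := he (col (g y)) ⟨g y, rfl⟩
  refine ⟨(fun y : X => (φ y).1) ⁻¹' U, hU.preimage hemb.continuous, ?_, fun z hz hcol => ?_⟩
  · simpa only [x, hfg, Set.mem_preimage] using hyU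
  · obtain ⟨hcol1, hcol2⟩ := Prod.mk.inj hcol
    have hz' : e (col (g y)) ⟨g z, hcol1⟩ = e (col (g y)) ⟨g y, rfl⟩ := by
      have hcongr : ∀ i (hi : col (g z) = i), e i ⟨g z, hi⟩ = e _ ⟨g z, rfl⟩ := by
        rintro _ rfl
        rfl
      rw [hcongr, hcol2]
    have := h ⟨g z, hcol1⟩ hz' (by simpa only [x, hfg, Set.mem_preimage] using hz)
    exact g.injective (congrArg Subtype.val this)
end
end
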